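/- The elements ξ_L := ı^{1/2} ȷ^{1/2} g_L and ξ_R := ı^{1/2} ȷ^{1/2} g_R satisfy: ξ_L ∈ A^L, ξ_R ∈ A^R, ξ_R = J(ξ_L), the element ξ := ξ_L ξ_R is positive and invertible with J(ξ) = ξ, and g = ξ_L ξ_R^{-1}. Moreover, for all x ∈ A, J^L(x) = ξ^{-1/2} J(x) ξ^{1/2} and J^R(x) = ξ^{1/2} J(x) ξ^{-1/2}, where J^L(x) := g_L^{-1} S(x) g_L and J^R(x) := g_L S^{-1}(x) g_L^{-1}; and for every n ≥ 1, Δ^{(n)}(ξ) = ξ_L 1_{(1)} ⊗ 1_{(2)} ⊗ ⋯ ⊗ 1_{(n)} ⊗ ξ_R 1_{(n+1)}. -/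

import Mathlib

open scoped TensorProduct

noncomputable section

/-- An element of a `C*`-algebra is positive iff it is of the form `star y * y`. -/
def IsPosElem {A : Type*} [Mul A] [Star A] (x : A) : Prop := ∃ y : A, x = star y * y

section Helpers

variable {A : Type*} [NormedRing A] [StarRing A] [CStarRing A]
  [NormedAlgebra ℂ A] [StarModule ℂ A]

/-- Apply a linear functional to the first leg of a tensor (`⟨φ, u₁⟩ u₂`). -/
def lapp (φ : A →ₗ[ℂ] ℂ) : A ⊗[ℂ] A →ₗ[ℂ] A :=
  (TensorProduct.lid ℂ A).toLinearMap ∘ₗ TensorProduct.map φ LinearMap.id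

/-- Apply a linear functional to the second leg of a tensor (`⟨φ, u₂⟩ u₁`). -/
def rapp (φ : A →ₗ[ℂ] ℂ) : A ⊗[ℂ] A →ₗ[ℂ] A :=
  (TensorProduct.rid ℂ A).toLinearMap ∘ₗ TensorProduct.map LinearMap.id φ

/-- Apply a pair of linear functionals to the two legs of a tensor (`⟨φ, u₁⟩⟨ψ, u₂⟩`). -/
def papp (φ ψ : A →ₗ[ℂ] ℂ) : A ⊗[ℂ] A →ₗ[ℂ] ℂ :=
  (TensorProduct.lid ℂ ℂ).toLinearMap ∘ₗ TensorProduct.map φ ψ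

end Helpers

/-- A `C*`-weak Hopf algebra: a finite-dimensional unital `C*`-algebra `A` equipped with a
comultiplication `Δ` (written in Sweedler notation `Δ x = x₍₁₎ ⊗ x₍₂₎`), counit `ε` and
antipode `S`, satisfying the axioms of Böhm–Szlachányi.  The field `starT` is the
(componentwise) star operation on `A ⊗[ℂ] A`, characterized by additivity and its values on
pure tensors. -/
structure WeakHopfData (A : Type*) [NormedRing A] [StarRing A] [CStarRing A]
    [NormedAlgebra ℂ A] [StarModule ℂ A] [FiniteDimensional ℂ A] : Type _ where
  Δ : A →ₗ[ℂ] A ⊗[ℂ] A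
  ε : A →ₗ[ℂ] ℂ
  S : A ≃ₗ[ℂ] A
  starT : A ⊗[ℂ] A → A ⊗[ℂ] A
  starT_add : ∀ u v : A ⊗[ℂ] A, starT (u + v) = starT u + starT v
  starT_tmul : ∀ a b : A, starT (a ⊗ₜ[ℂ] b) = star a ⊗ₜ[ℂ] star b
  /-- coassociativity of the comultiplication -/
  coassoc : (TensorProduct.assoc ℂ A A A).toLinearMap ∘ₗ
      (TensorProduct.map Δ LinearMap.id) ∘ₗ Δ = (TensorProduct.map LinearMap.id Δ) ∘ₗ Δ
  /-- counit axiom, left version -/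
  counit_left : (TensorProduct.lid ℂ A).toLinearMap ∘ₗ (TensorProduct.map ε LinearMap.id) ∘ₗ Δ
      = LinearMap.id
  /-- counit axiom, right version -/
  counit_right : (TensorProduct.rid ℂ A).toLinearMap ∘ₗ (TensorProduct.map LinearMap.id ε) ∘ₗ Δ
      = LinearMap.id
  /-- the comultiplication is multiplicative -/
  Δ_mul : ∀ x y : A, Δ (x * y) = Δ x * Δ y
  /-- the star operation is comultiplicative -/
  Δ_star : ∀ x : A, Δ (star x) = starT (Δ x)
  /-- the unit is weakly comultiplicative:
  `(Δ ⊗ id)(Δ 1) = (Δ 1 ⊗ 1)(1 ⊗ Δ 1)` -/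
  Δ_one_weak : (TensorProduct.map Δ LinearMap.id) (Δ 1)
      = (Δ 1 ⊗ₜ[ℂ] (1 : A)) * ((TensorProduct.assoc ℂ A A A).symm ((1 : A) ⊗ₜ[ℂ] Δ 1))
  /-- the unit is weakly comultiplicative:
  `(Δ ⊗ id)(Δ 1) = (1 ⊗ Δ 1)(Δ 1 ⊗ 1)` -/
  Δ_one_weak' : (TensorProduct.map Δ LinearMap.id) (Δ 1)
      = ((TensorProduct.assoc ℂ A A A).symm ((1 : A) ⊗ₜ[ℂ] Δ 1)) * (Δ 1 ⊗ₜ[ℂ] (1 : A))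
  /-- the counit is weakly multiplicative: `ε (x y z) = ε (x y₍₁₎) ε (y₍₂₎ z)` -/
  ε_weak : ∀ x y z : A,
      ε (x * y * z) = papp (ε ∘ₗ LinearMap.mulLeft ℂ x) (ε ∘ₗ LinearMap.mulRight ℂ z) (Δ y)
  /-- the counit is weakly multiplicative: `ε (x y z) = ε (x y₍₂₎) ε (y₍₁₎ z)` -/
  ε_weak' : ∀ x y z : A,
      ε (x * y * z) = papp (ε ∘ₗ LinearMap.mulRight ℂ z) (ε ∘ₗ LinearMap.mulLeft ℂ x) (Δ y)
  /-- antipode axiom: `x₍₁₎ S(x₍₂₎) = ε (1₍₁₎ x) 1₍₂₎` -/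
  antipode_left : ∀ x : A,
      LinearMap.mul' ℂ A ((TensorProduct.map LinearMap.id S.toLinearMap) (Δ x))
        = lapp (ε ∘ₗ LinearMap.mulRight ℂ x) (Δ 1)
  /-- antipode axiom: `S(x₍₁₎) x₍₂₎ = 1₍₁₎ ε (x 1₍₂₎)` -/
  antipode_right : ∀ x : A,
      LinearMap.mul' ℂ A ((TensorProduct.map S.toLinearMap LinearMap.id) (Δ x))
        = rapp (ε ∘ₗ LinearMap.mulLeft ℂ x) (Δ 1)
  /-- the antipode is antimultiplicative -/
  S_antimul : ∀ x y : A, S (x * y) = S y * S x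
  /-- the antipode is anticomultiplicative -/
  S_anticomul : ∀ x : A,
      Δ (S x) = (TensorProduct.comm ℂ A A) ((TensorProduct.map S.toLinearMap S.toLinearMap) (Δ x))

namespace WeakHopfData

variable {A : Type*} [NormedRing A] [StarRing A] [CStarRing A]
  [NormedAlgebra ℂ A] [StarModule ℂ A] [FiniteDimensional ℂ A]

/-- The source counital map `ε^L (x) = x₍₁₎ S(x₍₂₎)`. -/
def εL (W : WeakHopfData A) : A →ₗ[ℂ] A :=
  LinearMap.mul' ℂ A ∘ₗ TensorProduct.map LinearMap.id W.S.toLinearMap ∘ₗ W.Δ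

/-- The target counital map `ε^R (x) = S(x₍₁₎) x₍₂₎`. -/
def εR (W : WeakHopfData A) : A →ₗ[ℂ] A :=
  LinearMap.mul' ℂ A ∘ₗ TensorProduct.map W.S.toLinearMap LinearMap.id ∘ₗ W.Δ

/-- Full contraction of the iterated coproduct `Δ⁽ⁿ⁾ x = x₍₁₎ ⊗ ⋯ ⊗ x₍ₙ₊₁₎` against a family
of `n+1` linear functionals: `sweedlerEval W n φ x = ⟨φ 0, x₍₁₎⟩ ⋯ ⟨φ n, x₍ₙ₊₁₎⟩`.
Since linear functionals separate the points of a tensor power, identities between iterated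
coproducts are faithfully expressed through these contractions. -/
def sweedlerEval (W : WeakHopfData A) : (n : ℕ) → (Fin (n + 1) → (A →ₗ[ℂ] ℂ)) → (A →ₗ[ℂ] ℂ)
  | 0, φ => φ 0
  | n + 1, φ => papp (sweedlerEval W n (Fin.init φ)) (φ (Fin.last (n + 1))) ∘ₗ W.Δ

end WeakHopfData

/-- A `C*`-weak Hopf algebra together with its canonical distinguished elements:
the Haar integral `h`, the dual Haar integral `hHat`, the square roots `gL`, `gR` of
`E^L h`, `E^R h` (whence the canonical grouplike element `g = gL * gR⁻¹`), real powers
`gLpow`, `gRpow` of `gL` and `gR`, and a positive square root operation `sqrt`;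
all characterized by the (uniquely determining) properties listed as fields. -/
structure HaarPkg (A : Type*) [NormedRing A] [StarRing A] [CStarRing A]
    [NormedAlgebra ℂ A] [StarModule ℂ A] [FiniteDimensional ℂ A] : Type _ where
  W : WeakHopfData A
  /-- the Haar integral -/
  h : A
  haar_left : ∀ x : A, x * h = WeakHopfData.εL W x * h
  haar_right : ∀ x : A, h * x = h * WeakHopfData.εR W x
  haar_counitL : WeakHopfData.εL W h = 1
  haar_counitR : WeakHopfData.εR W h = 1
  haar_idem : h * h = h
  haar_star : star h = h
  haar_S : W.S h = h
  haar_nondeg : ∀ y : A, ∃ φ ψ : A →ₗ[ℂ] ℂ, lapp φ (W.Δ h) = y ∧ rapp ψ (W.Δ h) = y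
  /-- the Haar integral of the dual weak Hopf algebra `A*`, as a linear functional on `A` -/
  hHat : A →ₗ[ℂ] ℂ
  hHat_pos : ∀ x : A, ∃ r : ℝ, 0 ≤ r ∧ hHat (star x * x) = (r : ℂ)
  hHat_S : ∀ x : A, hHat (W.S x) = hHat x
  /-- `gL = (E^L h)^{1/2}` -/
  gL : A
  /-- `gR = (E^R h)^{1/2}` -/
  gR : A
  gL_pos : IsPosElem gL
  gR_pos : IsPosElem gR
  gL_unit : IsUnit gL
  gR_unit : IsUnit gR
  gL_sq : gL * gL = rapp hHat (W.Δ h)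
  gR_sq : gR * gR = lapp hHat (W.Δ h)
  gL_mem : gL ∈ Set.range (WeakHopfData.εL W)
  gR_mem : gR ∈ Set.range (WeakHopfData.εR W)
  gR_S : gR = W.S gL
  gLR_comm : gL * gR = gR * gL
  /-- the canonical grouplike element `g = gL * gR⁻¹` is positive -/
  g_pos : IsPosElem (gL * Ring.inverse gR)
  g_unit : IsUnit (gL * Ring.inverse gR)
  /-- `Δ g = (g ⊗ g) Δ 1` -/
  g_grouplike : W.Δ (gL * Ring.inverse gR)
      = ((gL * Ring.inverse gR) ⊗ₜ[ℂ] (gL * Ring.inverse gR)) * W.Δ 1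
  /-- `Δ g = Δ 1 (g ⊗ g)` -/
  g_grouplike' : W.Δ (gL * Ring.inverse gR)
      = W.Δ 1 * ((gL * Ring.inverse gR) ⊗ₜ[ℂ] (gL * Ring.inverse gR))
  /-- `S g = g⁻¹` -/
  g_S : W.S (gL * Ring.inverse gR) = Ring.inverse (gL * Ring.inverse gR)
  /-- `S² x = g x g⁻¹` -/
  S_sq : ∀ x : A,
      W.S (W.S x) = (gL * Ring.inverse gR) * x * Ring.inverse (gL * Ring.inverse gR)
  /-- `h₍₁₎ ⊗ g h₍₂₎ g = h₍₂₎ ⊗ h₍₁₎` -/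
  haar_flip : TensorProduct.map LinearMap.id
      (LinearMap.mulLeft ℂ (gL * Ring.inverse gR) ∘ₗ LinearMap.mulRight ℂ (gL * Ring.inverse gR))
      (W.Δ h) = (TensorProduct.comm ℂ A A) (W.Δ h)
  /-- dual integral relation `⟨ĥ, x (h gL⁻²)⟩ = ε x` -/
  hHat_dual₁ : ∀ x : A, hHat (x * (h * (Ring.inverse gL * Ring.inverse gL))) = W.ε x
  /-- dual integral relation `⟨ĥ, (gR⁻² h) x⟩ = ε x` -/
  hHat_dual₂ : ∀ x : A, hHat ((Ring.inverse gR * Ring.inverse gR * h) * x) = W.ε x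
  /-- dual integral relation `⟨ĥ, (h gL⁻²)₍₂₎⟩ (h gL⁻²)₍₁₎ = 1` -/
  hHat_dual₃ : rapp hHat (W.Δ (h * (Ring.inverse gL * Ring.inverse gL))) = 1
  /-- dual integral relation `⟨ĥ, (gR⁻² h)₍₁₎⟩ (gR⁻² h)₍₂₎ = 1` -/
  hHat_dual₄ : lapp hHat (W.Δ (Ring.inverse gR * Ring.inverse gR * h)) = 1
  /-- the positive square root, via the continuous functional calculus -/
  sqrt : A → A
  sqrt_pos : ∀ x : A, IsPosElem x → IsPosElem (sqrt x)
  sqrt_mul_self : ∀ x : A, IsPosElem x → sqrt x * sqrt x = x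
  /-- real powers of `gL`, via the continuous functional calculus -/
  gLpow : ℝ → A
  /-- real powers of `gR`, via the continuous functional calculus -/
  gRpow : ℝ → A
  gLpow_one : gLpow 1 = gL
  gRpow_one : gRpow 1 = gR
  gLpow_zero : gLpow 0 = 1
  gRpow_zero : gRpow 0 = 1
  gLpow_add : ∀ s t : ℝ, gLpow (s + t) = gLpow s * gLpow t
  gRpow_add : ∀ s t : ℝ, gRpow (s + t) = gRpow s * gRpow t
  gLpow_pos : ∀ t : ℝ, IsPosElem (gLpow t)
  gRpow_pos : ∀ t : ℝ, IsPosElem (gRpow t)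
  gLpow_continuous : Continuous gLpow
  gRpow_continuous : Continuous gRpow

namespace HaarPkg

variable {A : Type*} [NormedRing A] [StarRing A] [CStarRing A]
  [NormedAlgebra ℂ A] [StarModule ℂ A] [FiniteDimensional ℂ A]
variable (P : HaarPkg A)

/-- The canonical grouplike element `g = gL gR⁻¹`. -/
def g : A := P.gL * Ring.inverse P.gR

/-- The Watatani index `ı = ε^L (h gL⁻²)` of the Haar conditional expectations. -/
def iotaEl : A := WeakHopfData.εL P.W (P.h * (Ring.inverse P.gL * Ring.inverse P.gL))

/-- The element `ȷ = ⟨ĥ, (gL⁻²)₍₁₎⟩ (gL⁻²)₍₂₎`, the dual analogue of the Watatani index. -/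
def jayEl : A := lapp P.hHat (P.W.Δ (Ring.inverse P.gL * Ring.inverse P.gL))

/-- The pulling-through element `Ω = ı⁻¹ gL⁻¹ h gL⁻¹`. -/
def Ω : A := Ring.inverse P.iotaEl * Ring.inverse P.gL * P.h * Ring.inverse P.gL

/-- The map `J x = g^{-1/2} S(x) g^{1/2}`, as a linear map. -/
def Jlin : A →ₗ[ℂ] A :=
  LinearMap.mulRight ℂ (P.sqrt P.g) ∘ₗ
    LinearMap.mulLeft ℂ (Ring.inverse (P.sqrt P.g)) ∘ₗ P.W.S.toLinearMap

/-- The functional `⟨ω, x⟩ = ⟨ĥ, ȷ⁻¹ gL⁻¹ gR⁻¹ x⟩` (the dual analogue of `Ω`). -/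
def ω : A →ₗ[ℂ] ℂ :=
  P.hHat ∘ₗ LinearMap.mulLeft ℂ (Ring.inverse P.jayEl * (Ring.inverse P.gL * Ring.inverse P.gR))

/-- `ξ_L = ı^{1/2} ȷ^{1/2} gL`. -/
def ξL : A := P.sqrt P.iotaEl * P.sqrt P.jayEl * P.gL

/-- `ξ_R = ı^{1/2} ȷ^{1/2} gR`. -/
def ξR : A := P.sqrt P.iotaEl * P.sqrt P.jayEl * P.gR

/-- `ξ = ξ_L ξ_R`. -/
def ξ : A := P.ξL * P.ξR

/-- `J^L x = gL⁻¹ S(x) gL`. -/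
def JL : A → A := fun x => Ring.inverse P.gL * P.W.S x * P.gL

/-- `J^R x = gL S⁻¹(x) gL⁻¹`. -/
def JR : A → A := fun x => P.gL * P.W.S.symm x * Ring.inverse P.gL

end HaarPkg

section CStar

/-- In a finite-dimensional `C*`-algebra, a positive square root of a positive element is a
polynomial in that element. -/
theorem CStarAlgebra.exists_aeval_eq_of_mul_self {A : Type*} [CStarAlgebra A]
    [FiniteDimensional ℂ A] {x y : A} (hx : IsPosElem x) (hy : IsPosElem y) (h : y * y = x) :
    ∃ p : Polynomial ℝ, Polynomial.aeval x p = y := by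
  let := CStarAlgebra.spectralOrder A
  have := CStarAlgebra.spectralOrderedRing A
  have hx0 : 0 ≤ x := CStarAlgebra.nonneg_iff_eq_star_mul_self.2 hx
  have hy0 : 0 ≤ y := CStarAlgebra.nonneg_iff_eq_star_mul_self.2 hy
  have hfin : (spectrum ℝ x).Finite := by
    have : FiniteDimensional ℝ A := FiniteDimensional.complexToReal A
    refine (Polynomial.rootSet_finite (minpoly ℝ x) ℝ).subset fun r hr => ?_
    rw [Polynomial.mem_rootSet]
    refine ⟨minpoly.ne_zero (Algebra.IsIntegral.isIntegral x), ?_⟩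
    have hmem := spectrum.subset_polynomial_aeval x (minpoly ℝ x) ⟨r, hr, rfl⟩
    rw [minpoly.aeval, spectrum.mem_iff, sub_zero] at hmem
    by_contra hne
    exact hmem ((IsUnit.mk0 _ hne).map (algebraMap ℝ A))
  refine ⟨Lagrange.interpolate hfin.toFinset id Real.sqrt, ?_⟩
  rw [← cfc_polynomial _ x, ← CFC.sqrt_unique h hy0, CFC.sqrt_eq_real_sqrt x hx0,
    cfcₙ_eq_cfc (hf := Real.continuous_sqrt.continuousOn)]
  exact cfc_congr fun r hr => Lagrange.eval_interpolate_at_node (v := id) Real.sqrt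
    Function.injective_id.injOn (hfin.mem_toFinset.2 hr)

theorem CStarAlgebra.eq_of_mul_self_eq {A : Type*} [CStarAlgebra A]
    {x y : A} (hx : IsPosElem x) (hy : IsPosElem y) (h : x * x = y * y) : x = y := by
  let := CStarAlgebra.spectralOrder A
  have := CStarAlgebra.spectralOrderedRing A
  exact (CFC.sqrt_unique h (CStarAlgebra.nonneg_iff_eq_star_mul_self.2 hx)).symm.trans
    (CFC.sqrt_unique rfl (CStarAlgebra.nonneg_iff_eq_star_mul_self.2 hy))

theorem CStarAlgebra.isPosElem_sum {A : Type*} [CStarAlgebra A] {ι : Type*} (s : Finset ι)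
    (f : ι → A) (hf : ∀ i ∈ s, IsPosElem (f i)) : IsPosElem (∑ i ∈ s, f i) := by
  let := CStarAlgebra.spectralOrder A
  have := CStarAlgebra.spectralOrderedRing A
  exact CStarAlgebra.nonneg_iff_eq_star_mul_self.1 <| Finset.sum_nonneg fun i hi =>
    CStarAlgebra.nonneg_iff_eq_star_mul_self.2 (hf i hi)

theorem CStarAlgebra.isPosElem_mul {A : Type*} [CStarAlgebra A]
    {x y : A} (hx : IsPosElem x) (hy : IsPosElem y) (h : Commute x y) : IsPosElem (x * y) := by
  let := CStarAlgebra.spectralOrder A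
  have := CStarAlgebra.spectralOrderedRing A
  exact CStarAlgebra.nonneg_iff_eq_star_mul_self.1 <| Commute.mul_nonneg
    (CStarAlgebra.nonneg_iff_eq_star_mul_self.2 hx)
    (CStarAlgebra.nonneg_iff_eq_star_mul_self.2 hy) h

/-- If finitely many squares `star y * y` sum up to an element annihilating `x` from the left,
each `y` annihilates `x`. -/
theorem CStarAlgebra.mul_eq_zero_of_sum_star_mul_self {A : Type*} [CStarAlgebra A] {ι : Type*}
    [Fintype ι] (f : ι → A) {x : A} (hx : (∑ i, star (f i) * f i) * x = 0) (i : ι) :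
    f i * x = 0 := by
  let := CStarAlgebra.spectralOrder A
  have := CStarAlgebra.spectralOrderedRing A
  have hsum : ∑ i, star (f i * x) * (f i * x) = 0 := by
    have : star x * ((∑ i, star (f i) * f i) * x) = 0 := by rw [hx, mul_zero]
    simpa [Finset.sum_mul, Finset.mul_sum, mul_assoc] using this
  have := (Finset.sum_eq_zero_iff_of_nonneg fun i _ => star_mul_self_nonneg (f i * x)).1 hsum i
    (Finset.mem_univ i)
  exact CStarRing.star_mul_self_eq_zero_iff _ |>.1 this

/-- A positive definite Hermitian form on a finite-dimensional space has an orthonormal basis. -/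
theorem exists_basis_of_inner_core {V : Type*} [AddCommGroup V] [Module ℂ V]
    [FiniteDimensional ℂ V] (c : InnerProductSpace.Core ℂ V) :
    ∃ b : Module.Basis (Fin (Module.finrank ℂ V)) ℂ V,
      ∀ i j, c.inner (b i) (b j) = if i = j then 1 else 0 := by
  let : NormedAddCommGroup V := c.toNormedAddCommGroup
  let : InnerProductSpace ℂ V := InnerProductSpace.ofCore c.toCore
  refine ⟨(stdOrthonormalBasis ℂ V).toBasis, fun i j => ?_⟩
  have := orthonormal_iff_ite.1 (stdOrthonormalBasis ℂ V).orthonormal i j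
  simpa using this

end CStar

section Tensor

variable {A : Type*} [NormedRing A] [NormedAlgebra ℂ A]

@[simp]
theorem lapp_tmul (f : A →ₗ[ℂ] ℂ) (a b : A) : lapp f (a ⊗ₜ[ℂ] b) = f a • b := by
  simp [lapp]

@[simp]
theorem rapp_tmul (f : A →ₗ[ℂ] ℂ) (a b : A) : rapp f (a ⊗ₜ[ℂ] b) = f b • a := by
  simp [rapp]

@[simp]
theorem papp_tmul (f k : A →ₗ[ℂ] ℂ) (a b : A) : papp f k (a ⊗ₜ[ℂ] b) = f a * k b := by
  simp [papp]

theorem lapp_mul_left (f : A →ₗ[ℂ] ℂ) (a : A) (t : A ⊗[ℂ] A) :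
    lapp f ((a ⊗ₜ[ℂ] 1) * t) = lapp (f ∘ₗ LinearMap.mulLeft ℂ a) t := by
  induction t using TensorProduct.induction_on with
  | zero => simp
  | tmul x y => simp
  | add u v hu hv => simp only [mul_add, map_add, hu, hv]

theorem lapp_mul_right (f : A →ₗ[ℂ] ℂ) (a : A) (t : A ⊗[ℂ] A) :
    lapp f (t * (a ⊗ₜ[ℂ] 1)) = lapp (f ∘ₗ LinearMap.mulRight ℂ a) t := by
  induction t using TensorProduct.induction_on with
  | zero => simp
  | tmul x y => simp
  | add u v hu hv => simp only [add_mul, map_add, hu, hv]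

theorem lapp_one_tmul_mul (f : A →ₗ[ℂ] ℂ) (a : A) (t : A ⊗[ℂ] A) :
    lapp f ((1 ⊗ₜ[ℂ] a) * t) = a * lapp f t := by
  induction t using TensorProduct.induction_on with
  | zero => simp
  | tmul x y => simp
  | add u v hu hv => simp only [mul_add, map_add, hu, hv]

theorem lapp_mul_one_tmul (f : A →ₗ[ℂ] ℂ) (a : A) (t : A ⊗[ℂ] A) :
    lapp f (t * (1 ⊗ₜ[ℂ] a)) = lapp f t * a := by
  induction t using TensorProduct.induction_on with
  | zero => simp
  | tmul x y => simp
  | add u v hu hv => simp only [add_mul, map_add, hu, hv]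

theorem rapp_one_tmul_mul (f : A →ₗ[ℂ] ℂ) (a : A) (t : A ⊗[ℂ] A) :
    rapp f ((1 ⊗ₜ[ℂ] a) * t) = rapp (f ∘ₗ LinearMap.mulLeft ℂ a) t := by
  induction t using TensorProduct.induction_on with
  | zero => simp
  | tmul x y => simp
  | add u v hu hv => simp only [mul_add, map_add, hu, hv]

theorem rapp_mul_one_tmul (f : A →ₗ[ℂ] ℂ) (a : A) (t : A ⊗[ℂ] A) :
    rapp f (t * (1 ⊗ₜ[ℂ] a)) = rapp (f ∘ₗ LinearMap.mulRight ℂ a) t := by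
  induction t using TensorProduct.induction_on with
  | zero => simp
  | tmul x y => simp
  | add u v hu hv => simp only [add_mul, map_add, hu, hv]

theorem rapp_tmul_one_mul (f : A →ₗ[ℂ] ℂ) (a : A) (t : A ⊗[ℂ] A) :
    rapp f ((a ⊗ₜ[ℂ] 1) * t) = a * rapp f t := by
  induction t using TensorProduct.induction_on with
  | zero => simp
  | tmul x y => simp
  | add u v hu hv => simp only [mul_add, map_add, hu, hv]

theorem rapp_mul_tmul_one (f : A →ₗ[ℂ] ℂ) (a : A) (t : A ⊗[ℂ] A) :
    rapp f (t * (a ⊗ₜ[ℂ] 1)) = rapp f t * a := by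
  induction t using TensorProduct.induction_on with
  | zero => simp
  | tmul x y => simp
  | add u v hu hv => simp only [add_mul, map_add, hu, hv]

theorem lapp_comm (f : A →ₗ[ℂ] ℂ) (t : A ⊗[ℂ] A) :
    lapp f (TensorProduct.comm ℂ A A t) = rapp f t := by
  induction t using TensorProduct.induction_on with
  | zero => simp
  | tmul x y => simp
  | add u v hu hv => simp only [map_add, hu, hv]

theorem comm_mul (s t : A ⊗[ℂ] A) :
    TensorProduct.comm ℂ A A (s * t) = TensorProduct.comm ℂ A A s * TensorProduct.comm ℂ A A t :=
  map_mul (Algebra.TensorProduct.comm ℂ A A) s t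

theorem apply_lapp_eq_apply_rapp (f k : A →ₗ[ℂ] ℂ) (t : A ⊗[ℂ] A) :
    k (lapp f t) = f (rapp k t) := by
  induction t using TensorProduct.induction_on with
  | zero => simp
  | tmul x y => simp [mul_comm]
  | add u v hu hv => simp only [map_add, hu, hv]

/-- The contraction of the outer legs of `(t ⊗ 1) (1 ⊗ s)`. -/
theorem lid_map_assoc_mul (f : A →ₗ[ℂ] ℂ) (t s : A ⊗[ℂ] A) :
    TensorProduct.lid ℂ (A ⊗[ℂ] A) (TensorProduct.map f LinearMap.id
      (TensorProduct.assoc ℂ A A A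
        ((t ⊗ₜ[ℂ] (1 : A)) * (TensorProduct.assoc ℂ A A A).symm ((1 : A) ⊗ₜ[ℂ] s))))
      = (lapp f t ⊗ₜ[ℂ] 1) * s := by
  induction t using TensorProduct.induction_on with
  | zero => simp
  | add u v hu hv => simp only [TensorProduct.add_tmul, add_mul, map_add, hu, hv]
  | tmul a b =>
    induction s using TensorProduct.induction_on with
    | zero => simp
    | add u v hu hv => simp only [TensorProduct.tmul_add, mul_add, map_add, hu, hv]
    | tmul c d => simp [← TensorProduct.smul_tmul']

theorem lid_map_assoc_mul' (f : A →ₗ[ℂ] ℂ) (t s : A ⊗[ℂ] A) :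
    TensorProduct.lid ℂ (A ⊗[ℂ] A) (TensorProduct.map f LinearMap.id
      (TensorProduct.assoc ℂ A A A
        ((TensorProduct.assoc ℂ A A A).symm ((1 : A) ⊗ₜ[ℂ] s) * (t ⊗ₜ[ℂ] (1 : A)))))
      = s * (lapp f t ⊗ₜ[ℂ] 1) := by
  induction t using TensorProduct.induction_on with
  | zero => simp
  | add u v hu hv => simp only [TensorProduct.add_tmul, mul_add, map_add, hu, hv]
  | tmul a b =>
    induction s using TensorProduct.induction_on with
    | zero => simp
    | add u v hu hv => simp only [TensorProduct.tmul_add, add_mul, map_add, hu, hv]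
    | tmul c d => simp [← TensorProduct.smul_tmul']

theorem rid_map_mul (f : A →ₗ[ℂ] ℂ) (t s : A ⊗[ℂ] A) :
    TensorProduct.rid ℂ (A ⊗[ℂ] A) (TensorProduct.map LinearMap.id f
        ((t ⊗ₜ[ℂ] (1 : A)) * (TensorProduct.assoc ℂ A A A).symm ((1 : A) ⊗ₜ[ℂ] s)))
      = t * (1 ⊗ₜ[ℂ] rapp f s) := by
  induction t using TensorProduct.induction_on with
  | zero => simp
  | add u v hu hv => simp only [TensorProduct.add_tmul, add_mul, map_add, hu, hv]
  | tmul a b =>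
    induction s using TensorProduct.induction_on with
    | zero => simp
    | add u v hu hv => simp only [TensorProduct.tmul_add, mul_add, map_add, hu, hv]
    | tmul c d => simp

theorem rid_map_mul' (f : A →ₗ[ℂ] ℂ) (t s : A ⊗[ℂ] A) :
    TensorProduct.rid ℂ (A ⊗[ℂ] A) (TensorProduct.map LinearMap.id f
        ((TensorProduct.assoc ℂ A A A).symm ((1 : A) ⊗ₜ[ℂ] s) * (t ⊗ₜ[ℂ] (1 : A))))
      = (1 ⊗ₜ[ℂ] rapp f s) * t := by
  induction t using TensorProduct.induction_on with
  | zero => simp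
  | add u v hu hv => simp only [TensorProduct.add_tmul, mul_add, map_add, hu, hv]
  | tmul a b =>
    induction s using TensorProduct.induction_on with
    | zero => simp
    | add u v hu hv => simp only [TensorProduct.tmul_add, add_mul, map_add, hu, hv]
    | tmul c d => simp

theorem map_lapp_assoc_mul (e : A →ₗ[ℂ] ℂ) (w t s : A ⊗[ℂ] A) :
    TensorProduct.map LinearMap.id (lapp e ∘ₗ LinearMap.mulLeft ℂ w)
      (TensorProduct.assoc ℂ A A A
        ((TensorProduct.assoc ℂ A A A).symm ((1 : A) ⊗ₜ[ℂ] s) * (t ⊗ₜ[ℂ] (1 : A))))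
      = TensorProduct.map LinearMap.id (lapp e ∘ₗ LinearMap.mulLeft ℂ (w * s))
        (TensorProduct.assoc ℂ A A A (t ⊗ₜ[ℂ] (1 : A))) := by
  induction t using TensorProduct.induction_on with
  | zero => simp
  | add u v hu hv => simp only [TensorProduct.add_tmul, mul_add, map_add, hu, hv]
  | tmul a b =>
    induction s using TensorProduct.induction_on with
    | zero => simp
    | add u v hu hv =>
      simp only [TensorProduct.tmul_add, mul_add, add_mul, map_add, hu, hv,
        TensorProduct.assoc_tmul, TensorProduct.map_tmul, LinearMap.comp_apply,
        LinearMap.mulLeft_apply]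
    | tmul c d => simp

theorem map_lapp_assoc_tmul_one (e : A →ₗ[ℂ] ℂ) (w t : A ⊗[ℂ] A) (R : A →ₗ[ℂ] A)
    (hR : ∀ c, R c = rapp (e ∘ₗ LinearMap.mulLeft ℂ c) t) :
    TensorProduct.map LinearMap.id (lapp e ∘ₗ LinearMap.mulLeft ℂ w)
        (TensorProduct.assoc ℂ A A A (t ⊗ₜ[ℂ] (1 : A)))
      = TensorProduct.map R LinearMap.id w := by
  induction w using TensorProduct.induction_on with
  | zero => simp
  | add u v hu hv =>
    rw [map_add, ← hu, ← hv]
    clear hu hv hR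
    induction t using TensorProduct.induction_on with
    | zero => simp
    | add p q hp hq => simp only [TensorProduct.add_tmul, map_add, hp, hq]; abel
    | tmul a b => simp [add_mul, TensorProduct.tmul_add]
  | tmul c d =>
    rw [TensorProduct.map_tmul, hR]
    clear hR
    induction t using TensorProduct.induction_on with
    | zero => simp
    | add p q hp hq => simp only [TensorProduct.add_tmul, map_add, hp, hq]
    | tmul a b => simp [TensorProduct.smul_tmul]

theorem eq_sum_tmul_lapp {ι : Type*} [Fintype ι] (b : Module.Basis ι ℂ A) (t : A ⊗[ℂ] A) :
    t = ∑ i, b i ⊗ₜ[ℂ] lapp (b.coord i) t := by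
  induction t using TensorProduct.induction_on with
  | zero => simp
  | tmul x y =>
    conv_lhs => rw [← b.sum_repr x, TensorProduct.sum_tmul]
    simp [← TensorProduct.smul_tmul']
  | add u v hu hv =>
    simp only [map_add, TensorProduct.tmul_add, Finset.sum_add_distrib, ← hu, ← hv]

theorem eq_sum_rapp_tmul {ι : Type*} [Fintype ι] (b : Module.Basis ι ℂ A) (t : A ⊗[ℂ] A) :
    t = ∑ i, rapp (b.coord i) t ⊗ₜ[ℂ] b i := by
  induction t using TensorProduct.induction_on with
  | zero => simp
  | tmul x y =>
    conv_lhs => rw [← b.sum_repr y, TensorProduct.tmul_sum]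
    simp [← TensorProduct.smul_tmul']
  | add u v hu hv =>
    simp only [map_add, TensorProduct.add_tmul, Finset.sum_add_distrib, ← hu, ← hv]

end Tensor

namespace WeakHopfData

variable {A : Type*} [NormedRing A] [StarRing A] [CStarRing A]
  [NormedAlgebra ℂ A] [StarModule ℂ A] [FiniteDimensional ℂ A] (W : WeakHopfData A)

theorem coassoc_apply (x : A) : TensorProduct.assoc ℂ A A A
    (TensorProduct.map W.Δ LinearMap.id (W.Δ x)) = TensorProduct.map LinearMap.id W.Δ (W.Δ x) :=
  LinearMap.congr_fun W.coassoc x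

theorem lapp_ε (x : A) : lapp W.ε (W.Δ x) = x := LinearMap.congr_fun W.counit_left x

theorem rapp_ε (x : A) : rapp W.ε (W.Δ x) = x := LinearMap.congr_fun W.counit_right x

theorem Δ_mul_Δ_one (x : A) : W.Δ x * W.Δ 1 = W.Δ x := by rw [← W.Δ_mul, mul_one]

theorem Δ_one_mul_Δ (x : A) : W.Δ 1 * W.Δ x = W.Δ x := by rw [← W.Δ_mul, one_mul]

theorem S_one : W.S 1 = 1 := by
  have h := W.S_antimul 1 (W.S.symm 1)
  rw [one_mul, W.S.apply_symm_apply, one_mul] at h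
  exact h.symm

theorem εL_eq (x : A) : W.εL x = lapp (W.ε ∘ₗ LinearMap.mulRight ℂ x) (W.Δ 1) :=
  W.antipode_left x

theorem εR_eq (x : A) : W.εR x = rapp (W.ε ∘ₗ LinearMap.mulLeft ℂ x) (W.Δ 1) :=
  W.antipode_right x

theorem εL_one : W.εL 1 = 1 := by
  rw [εL_eq]
  have : W.ε ∘ₗ LinearMap.mulRight ℂ 1 = W.ε := by ext; simp
  rw [this, lapp_ε]

theorem εR_one : W.εR 1 = 1 := by
  rw [εR_eq]
  have : W.ε ∘ₗ LinearMap.mulLeft ℂ 1 = W.ε := by ext; simp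
  rw [this, rapp_ε]

theorem ε_S (x : A) : W.ε (W.S x) = W.ε x := by
  have key : ∀ t : A ⊗[ℂ] A, W.S (W.S.symm (lapp W.ε (TensorProduct.comm ℂ A A
      (TensorProduct.map W.S.toLinearMap W.S.toLinearMap t))))
      = W.S (rapp (W.ε ∘ₗ W.S.toLinearMap) t) := by
    intro t
    induction t using TensorProduct.induction_on with
    | zero => simp
    | tmul a b => simp
    | add u v hu hv => simp only [map_add, hu, hv]
  have h := key (W.Δ x)
  rw [← W.S_anticomul, lapp_ε, W.S.symm_apply_apply] at h
  have h' := congrArg W.ε (W.S.injective h)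
  rw [← apply_lapp_eq_apply_rapp, lapp_ε] at h'
  exact h'.symm

/-- `t ↦ t₁ S(t₂)`. -/
def mulS : A ⊗[ℂ] A →ₗ[ℂ] A := LinearMap.mul' ℂ A ∘ₗ TensorProduct.map LinearMap.id W.S.toLinearMap

/-- `t ↦ S(t₁) t₂`. -/
def sMul : A ⊗[ℂ] A →ₗ[ℂ] A := LinearMap.mul' ℂ A ∘ₗ TensorProduct.map W.S.toLinearMap LinearMap.id

@[simp]
theorem mulS_tmul (a b : A) : W.mulS (a ⊗ₜ[ℂ] b) = a * W.S b := by simp [mulS]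

@[simp]
theorem sMul_tmul (a b : A) : W.sMul (a ⊗ₜ[ℂ] b) = W.S a * b := by simp [sMul]

theorem mulS_Δ (x : A) : W.mulS (W.Δ x) = W.εL x := rfl

theorem sMul_Δ (x : A) : W.sMul (W.Δ x) = W.εR x := rfl

theorem mulS_tmul_one_mul (a : A) (t : A ⊗[ℂ] A) :
    W.mulS ((a ⊗ₜ[ℂ] 1) * t) = a * W.mulS t := by
  induction t using TensorProduct.induction_on with
  | zero => simp
  | tmul x y => simp [mul_assoc]
  | add u v hu hv => simp only [mul_add, map_add, hu, hv]

theorem mulS_one_tmul_mul (a : A) (t : A ⊗[ℂ] A) :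
    W.mulS ((1 ⊗ₜ[ℂ] a) * t) = W.mulS t * W.S a := by
  induction t using TensorProduct.induction_on with
  | zero => simp
  | tmul x y => simp [mul_assoc, W.S_antimul]
  | add u v hu hv => simp only [mul_add, add_mul, map_add, hu, hv]

theorem sMul_mul_one_tmul (a : A) (t : A ⊗[ℂ] A) :
    W.sMul (t * (1 ⊗ₜ[ℂ] a)) = W.sMul t * a := by
  induction t using TensorProduct.induction_on with
  | zero => simp
  | tmul x y => simp [mul_assoc]
  | add u v hu hv => simp only [add_mul, map_add, hu, hv]

theorem Δ_lapp_Δ_one (f : A →ₗ[ℂ] ℂ) :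
    W.Δ (lapp f (W.Δ 1)) = (lapp f (W.Δ 1) ⊗ₜ[ℂ] 1) * W.Δ 1 ∧
    W.Δ (lapp f (W.Δ 1)) = W.Δ 1 * (lapp f (W.Δ 1) ⊗ₜ[ℂ] 1) := by
  have key : ∀ t : A ⊗[ℂ] A, W.Δ (lapp f t) = TensorProduct.lid ℂ (A ⊗[ℂ] A)
      (TensorProduct.map f LinearMap.id (TensorProduct.map LinearMap.id W.Δ t)) := by
    intro t
    induction t using TensorProduct.induction_on with
    | zero => simp
    | tmul x y => simp
    | add u v hu hv => simp only [map_add, hu, hv]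
  constructor
  · rw [key, ← coassoc_apply, W.Δ_one_weak, lid_map_assoc_mul]
  · rw [key, ← coassoc_apply, W.Δ_one_weak', lid_map_assoc_mul']

theorem Δ_rapp_Δ_one (f : A →ₗ[ℂ] ℂ) :
    W.Δ (rapp f (W.Δ 1)) = W.Δ 1 * (1 ⊗ₜ[ℂ] rapp f (W.Δ 1)) ∧
    W.Δ (rapp f (W.Δ 1)) = (1 ⊗ₜ[ℂ] rapp f (W.Δ 1)) * W.Δ 1 := by
  have key : ∀ t : A ⊗[ℂ] A, W.Δ (rapp f t) = TensorProduct.rid ℂ (A ⊗[ℂ] A)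
      (TensorProduct.map LinearMap.id f (TensorProduct.map W.Δ LinearMap.id t)) := by
    intro t
    induction t using TensorProduct.induction_on with
    | zero => simp
    | tmul x y => simp
    | add u v hu hv => simp only [map_add, hu, hv]
  constructor
  · rw [key, W.Δ_one_weak, rid_map_mul]
  · rw [key, W.Δ_one_weak', rid_map_mul']

/-- The subalgebra `A^L`. -/
def subL : Subalgebra ℂ A where
  carrier := {l | W.Δ l = (l ⊗ₜ[ℂ] 1) * W.Δ 1}
  mul_mem' {a b} ha hb := by
    simp only [Set.mem_ofPred_eq] at *
    rw [W.Δ_mul, ha, mul_assoc, Δ_one_mul_Δ, hb, ← mul_assoc]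
    simp
  add_mem' {a b} ha hb := by
    simp only [Set.mem_ofPred_eq] at *
    rw [map_add, ha, hb, TensorProduct.add_tmul, add_mul]
  algebraMap_mem' c := by
    simp [Algebra.algebraMap_eq_smul_one, ← TensorProduct.smul_tmul',
      ← Algebra.TensorProduct.one_def]

/-- The subalgebra `A^R`. -/
def subR : Subalgebra ℂ A where
  carrier := {r | W.Δ r = W.Δ 1 * (1 ⊗ₜ[ℂ] r)}
  mul_mem' {a b} ha hb := by
    simp only [Set.mem_ofPred_eq] at *
    rw [W.Δ_mul, hb, ← mul_assoc, Δ_mul_Δ_one, ha, mul_assoc]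
    simp
  add_mem' {a b} ha hb := by
    simp only [Set.mem_ofPred_eq] at *
    rw [map_add, ha, hb, TensorProduct.tmul_add, mul_add]
  algebraMap_mem' c := by
    simp [Algebra.algebraMap_eq_smul_one, ← Algebra.TensorProduct.one_def]

variable {W}

theorem mem_subL {x : A} : x ∈ W.subL ↔ W.Δ x = (x ⊗ₜ[ℂ] 1) * W.Δ 1 := Iff.rfl

theorem mem_subR {x : A} : x ∈ W.subR ↔ W.Δ x = W.Δ 1 * (1 ⊗ₜ[ℂ] x) := Iff.rfl

theorem εL_of_mem_subL {x : A} (hx : x ∈ W.subL) : W.εL x = x := by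
  rw [← mulS_Δ, mem_subL.1 hx, mulS_tmul_one_mul, mulS_Δ, εL_one, mul_one]

theorem εR_of_mem_subR {x : A} (hx : x ∈ W.subR) : W.εR x = x := by
  rw [← sMul_Δ, mem_subR.1 hx, sMul_mul_one_tmul, sMul_Δ, εR_one, one_mul]

theorem mem_subL_iff_range {x : A} : x ∈ W.subL ↔ x ∈ Set.range W.εL := by
  refine ⟨fun hx => ⟨x, εL_of_mem_subL hx⟩, ?_⟩
  rintro ⟨y, rfl⟩
  rw [εL_eq]
  exact (W.Δ_lapp_Δ_one _).1

theorem mem_subR_iff_range {x : A} : x ∈ W.subR ↔ x ∈ Set.range W.εR := by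
  refine ⟨fun hx => ⟨x, εR_of_mem_subR hx⟩, ?_⟩
  rintro ⟨y, rfl⟩
  rw [εR_eq]
  exact (W.Δ_rapp_Δ_one _).1

theorem lapp_Δ_one_mem_subL (f : A →ₗ[ℂ] ℂ) : lapp f (W.Δ 1) ∈ W.subL := (W.Δ_lapp_Δ_one f).1

theorem rapp_Δ_one_mem_subR (f : A →ₗ[ℂ] ℂ) : rapp f (W.Δ 1) ∈ W.subR := (W.Δ_rapp_Δ_one f).1

theorem exists_eq_lapp {x : A} (hx : x ∈ W.subL) : ∃ f, x = lapp f (W.Δ 1) :=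
  ⟨_, (εL_of_mem_subL hx).symm.trans (W.εL_eq x)⟩

theorem exists_eq_rapp {x : A} (hx : x ∈ W.subR) : ∃ f, x = rapp f (W.Δ 1) :=
  ⟨_, (εR_of_mem_subR hx).symm.trans (W.εR_eq x)⟩

theorem Δ_of_mem_subL {x : A} (hx : x ∈ W.subL) : W.Δ x = W.Δ 1 * (x ⊗ₜ[ℂ] 1) := by
  obtain ⟨f, rfl⟩ := exists_eq_lapp hx
  exact (W.Δ_lapp_Δ_one f).2

theorem Δ_of_mem_subR {x : A} (hx : x ∈ W.subR) : W.Δ x = (1 ⊗ₜ[ℂ] x) * W.Δ 1 := by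
  obtain ⟨f, rfl⟩ := exists_eq_rapp hx
  exact (W.Δ_rapp_Δ_one f).2

theorem Δ_mul_left_of_mem_subL {l : A} (hl : l ∈ W.subL) (x : A) :
    W.Δ (l * x) = (l ⊗ₜ[ℂ] 1) * W.Δ x := by
  rw [W.Δ_mul, mem_subL.1 hl, mul_assoc, Δ_one_mul_Δ]

theorem Δ_mul_right_of_mem_subL {l : A} (hl : l ∈ W.subL) (x : A) :
    W.Δ (x * l) = W.Δ x * (l ⊗ₜ[ℂ] 1) := by
  rw [W.Δ_mul, Δ_of_mem_subL hl, ← mul_assoc, Δ_mul_Δ_one]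

theorem Δ_mul_left_of_mem_subR {r : A} (hr : r ∈ W.subR) (x : A) :
    W.Δ (r * x) = (1 ⊗ₜ[ℂ] r) * W.Δ x := by
  rw [W.Δ_mul, Δ_of_mem_subR hr, mul_assoc, Δ_one_mul_Δ]

theorem εL_of_mem_subR {r : A} (hr : r ∈ W.subR) : W.εL r = W.S r := by
  rw [← mulS_Δ, Δ_of_mem_subR hr, mulS_one_tmul_mul, mulS_Δ, εL_one, one_mul]

theorem S_eq_self {x : A} (hl : x ∈ W.subL) (hr : x ∈ W.subR) : W.S x = x := by
  rw [← εL_of_mem_subR hr, εL_of_mem_subL hl]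

theorem commute_of_mem {l r : A} (hl : l ∈ W.subL) (hr : r ∈ W.subR) : Commute l r := by
  obtain ⟨f, rfl⟩ := exists_eq_lapp hl
  obtain ⟨k, rfl⟩ := exists_eq_rapp hr
  have h := congrArg (fun t => rapp k (TensorProduct.lid ℂ (A ⊗[ℂ] A)
    (TensorProduct.map f LinearMap.id (TensorProduct.assoc ℂ A A A t))))
    (W.Δ_one_weak.symm.trans W.Δ_one_weak')
  simp only [lid_map_assoc_mul, lid_map_assoc_mul'] at h
  rwa [rapp_tmul_one_mul, rapp_mul_tmul_one] at h

theorem S_mem_subR {l : A} (hl : l ∈ W.subL) : W.S l ∈ W.subR := by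
  obtain ⟨f, rfl⟩ := exists_eq_lapp hl
  have key : ∀ t : A ⊗[ℂ] A, W.S (lapp f t) = rapp (f ∘ₗ W.S.symm.toLinearMap)
      (TensorProduct.comm ℂ A A (TensorProduct.map W.S.toLinearMap W.S.toLinearMap t)) := by
    intro t
    induction t using TensorProduct.induction_on with
    | zero => simp
    | tmul x y => simp
    | add u v hu hv => simp only [map_add, hu, hv]
  rw [key, ← W.S_anticomul, S_one]
  exact rapp_Δ_one_mem_subR _

theorem inverse_mem_subL {l : A} (hl : l ∈ W.subL) (hu : IsUnit l) :
    Ring.inverse l ∈ W.subL := by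
  rw [mem_subL]
  have h := Δ_mul_left_of_mem_subL hl (Ring.inverse l)
  rw [Ring.mul_inverse_cancel _ hu] at h
  rw [h, ← mul_assoc]
  simp [Ring.inverse_mul_cancel _ hu, ← Algebra.TensorProduct.one_def]

/-- An element `l` of `A^L` is central as soon as `ε (l x) = ε (x l)` for all `x`. -/
theorem mul_comm_of_ε {l : A} (hl : l ∈ W.subL) (h : ∀ x, W.ε (l * x) = W.ε (x * l)) (x : A) :
    l * x = x * l := by
  rw [← W.lapp_ε (l * x), ← W.lapp_ε (x * l), Δ_mul_left_of_mem_subL hl,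
    Δ_mul_right_of_mem_subL hl, lapp_mul_left, lapp_mul_right]
  have : W.ε ∘ₗ LinearMap.mulLeft ℂ l = W.ε ∘ₗ LinearMap.mulRight ℂ l := LinearMap.ext h
  rw [this]

variable (W)

theorem sMul_comm_map_S (t : A ⊗[ℂ] A) : W.sMul (TensorProduct.comm ℂ A A
    (TensorProduct.map W.S.toLinearMap W.S.toLinearMap t)) = W.S (W.mulS t) := by
  induction t using TensorProduct.induction_on with
  | zero => simp
  | tmul x y => simp [W.S_antimul]
  | add u v hu hv => simp only [map_add, hu, hv]

theorem εR_S (x : A) : W.εR (W.S x) = W.S (W.εL x) := by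
  rw [← sMul_Δ, W.S_anticomul, sMul_comm_map_S, mulS_Δ]

/-- `ε^R(x₍₁₎) ⊗ x₍₂₎ = 1₍₁₎ ⊗ x 1₍₂₎`. -/
theorem map_εR_Δ (x : A) :
    TensorProduct.map W.εR LinearMap.id (W.Δ x) = (1 ⊗ₜ[ℂ] x) * W.Δ 1 := by
  have key : ∀ t : A ⊗[ℂ] A,
      TensorProduct.map LinearMap.id (lapp W.ε ∘ₗ LinearMap.mulLeft ℂ (W.Δ x))
      (TensorProduct.map LinearMap.id W.Δ t) = (1 ⊗ₜ[ℂ] x) * t := by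
    intro t
    induction t using TensorProduct.induction_on with
    | zero => simp
    | tmul a b => simp [← W.Δ_mul, lapp_ε]
    | add u v hu hv => simp only [map_add, mul_add, hu, hv]
  rw [← key, ← coassoc_apply, W.Δ_one_weak', map_lapp_assoc_mul, Δ_mul_Δ_one,
    map_lapp_assoc_tmul_one _ _ _ _ W.εR_eq]

/-- The linear map `a ⊗ t ↦ (S(a) ⊗ 1) t`. -/
def sAct : A ⊗[ℂ] (A ⊗[ℂ] A) →ₗ[ℂ] A ⊗[ℂ] A :=
  LinearMap.mul' ℂ (A ⊗[ℂ] A) ∘ₗ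
    TensorProduct.map ((TensorProduct.mk ℂ A A).flip 1 ∘ₗ W.S.toLinearMap) LinearMap.id

@[simp]
theorem sAct_tmul (a : A) (t : A ⊗[ℂ] A) :
    W.sAct (a ⊗ₜ[ℂ] t) = (W.S a ⊗ₜ[ℂ] 1) * t := by simp [sAct]

theorem sAct_assoc (t : (A ⊗[ℂ] A) ⊗[ℂ] A) : W.sAct (TensorProduct.assoc ℂ A A A t)
    = TensorProduct.map W.sMul LinearMap.id t := by
  induction t using TensorProduct.induction_on with
  | zero => simp
  | add u v hu hv => simp only [map_add, hu, hv]
  | tmul s c =>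
    induction s using TensorProduct.induction_on with
    | zero => simp
    | add u v hu hv => simp only [map_add, TensorProduct.add_tmul, hu, hv]
    | tmul a b => simp

/-- `S(x₍₁₎) x₍₂₎ ⊗ x₍₃₎ = 1₍₁₎ ⊗ x 1₍₂₎`. -/
theorem sAct_map_Δ (x : A) :
    W.sAct (TensorProduct.map LinearMap.id W.Δ (W.Δ x)) = (1 ⊗ₜ[ℂ] x) * W.Δ 1 := by
  rw [← coassoc_apply, sAct_assoc, ← map_εR_Δ, ← LinearMap.comp_apply, ← TensorProduct.map_comp]
  rfl

/-- `S(x₍₁₎) x₍₂₎ S(x₍₃₎) = S(x)`. -/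
theorem sMul_map_εL (x : A) :
    W.sMul (TensorProduct.map LinearMap.id W.εL (W.Δ x)) = W.S x := by
  have key : ∀ t : A ⊗[ℂ] A, W.sMul (TensorProduct.map LinearMap.id W.εL t)
      = W.mulS (W.sAct (TensorProduct.map LinearMap.id W.Δ t)) := by
    intro t
    induction t using TensorProduct.induction_on with
    | zero => simp
    | tmul a b => simp [mulS_tmul_one_mul, mulS_Δ]
    | add u v hu hv => simp only [map_add, hu, hv]
  rw [key, sAct_map_Δ, mulS_one_tmul_mul, mulS_Δ, εL_one, one_mul]

/-- Left invariance of a left integral `h`: `h₍₁₎ ⊗ x h₍₂₎ = S(x) h₍₁₎ ⊗ h₍₂₎`. -/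
theorem one_tmul_mul_Δ_of_integral {h : A} (hh : ∀ x, x * h = W.εL x * h) (x : A) :
    (1 ⊗ₜ[ℂ] x) * W.Δ h = (W.S x ⊗ₜ[ℂ] 1) * W.Δ h := by
  have key₁ : ∀ t : A ⊗[ℂ] A, W.sAct (TensorProduct.map LinearMap.id
      (W.Δ ∘ₗ LinearMap.mulRight ℂ h) t)
      = W.sAct (TensorProduct.map LinearMap.id W.Δ t) * W.Δ h := by
    intro t
    induction t using TensorProduct.induction_on with
    | zero => simp
    | tmul a b => simp [W.Δ_mul, mul_assoc]
    | add u v hu hv => simp only [map_add, add_mul, hu, hv]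
  have key₂ : ∀ t : A ⊗[ℂ] A, W.sAct (TensorProduct.map LinearMap.id
      (W.Δ ∘ₗ LinearMap.mulRight ℂ h) t)
      = (W.sMul (TensorProduct.map LinearMap.id W.εL t) ⊗ₜ[ℂ] 1) * W.Δ h := by
    intro t
    induction t using TensorProduct.induction_on with
    | zero => simp
    | tmul a b =>
      simp only [TensorProduct.map_tmul, LinearMap.id_coe, id_eq, LinearMap.comp_apply,
        LinearMap.mulRight_apply, sAct_tmul, sMul_tmul]
      rw [hh, Δ_mul_left_of_mem_subL (mem_subL_iff_range.2 ⟨b, rfl⟩), ← mul_assoc]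
      simp
    | add u v hu hv => simp only [map_add, TensorProduct.add_tmul, add_mul, hu, hv]
  have h := key₂ (W.Δ x)
  rwa [key₁, sAct_map_Δ, mul_assoc, Δ_one_mul_Δ, sMul_map_εL] at h

theorem comm_map_S_one_tmul_mul (x : A) (t : A ⊗[ℂ] A) :
    TensorProduct.comm ℂ A A (TensorProduct.map W.S.toLinearMap W.S.toLinearMap
      ((1 ⊗ₜ[ℂ] x) * t)) = TensorProduct.comm ℂ A A
        (TensorProduct.map W.S.toLinearMap W.S.toLinearMap t) * (W.S x ⊗ₜ[ℂ] 1) := by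
  induction t using TensorProduct.induction_on with
  | zero => simp
  | tmul a b => simp [W.S_antimul]
  | add u v hu hv => simp only [map_add, mul_add, add_mul, hu, hv]

theorem comm_map_S_tmul_one_mul (x : A) (t : A ⊗[ℂ] A) :
    TensorProduct.comm ℂ A A (TensorProduct.map W.S.toLinearMap W.S.toLinearMap
      ((x ⊗ₜ[ℂ] 1) * t)) = TensorProduct.comm ℂ A A
        (TensorProduct.map W.S.toLinearMap W.S.toLinearMap t) * (1 ⊗ₜ[ℂ] W.S x) := by
  induction t using TensorProduct.induction_on with
  | zero => simp
  | tmul a b => simp [W.S_antimul]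
  | add u v hu hv => simp only [map_add, mul_add, add_mul, hu, hv]

/-- `h₍₁₎ x ⊗ h₍₂₎ = h₍₁₎ ⊗ h₍₂₎ S(x)` for an `S`-invariant left integral `h`. -/
theorem Δ_mul_tmul_one_of_integral {h : A} (hh : ∀ x, x * h = W.εL x * h) (hS : W.S h = h)
    (x : A) : W.Δ h * (x ⊗ₜ[ℂ] 1) = W.Δ h * (1 ⊗ₜ[ℂ] W.S x) := by
  obtain ⟨y, rfl⟩ := W.S.surjective x
  have key := congrArg (fun t => TensorProduct.comm ℂ A A
    (TensorProduct.map W.S.toLinearMap W.S.toLinearMap t)) (W.one_tmul_mul_Δ_of_integral hh y)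
  simp only [comm_map_S_one_tmul_mul, comm_map_S_tmul_one_mul, ← W.S_anticomul, hS] at key
  exact key

theorem rapp_Δ_lapp_Δ (f k : A →ₗ[ℂ] ℂ) (w : A) :
    rapp k (W.Δ (lapp f (W.Δ w))) = lapp f (W.Δ (rapp k (W.Δ w))) := by
  have key₁ : ∀ t : A ⊗[ℂ] A, rapp k (W.Δ (lapp f t)) = TensorProduct.lid ℂ A
      (TensorProduct.map f (rapp k) (TensorProduct.map LinearMap.id W.Δ t)) := by
    intro t
    induction t using TensorProduct.induction_on with
    | zero => simp
    | tmul a b => simp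
    | add u v hu hv => simp only [map_add, hu, hv]
  have key₂ : ∀ (s : A ⊗[ℂ] A) (c : A), k c • lapp f s = TensorProduct.lid ℂ A
      (TensorProduct.map f (rapp k) (TensorProduct.assoc ℂ A A A (s ⊗ₜ[ℂ] c))) := by
    intro s c
    induction s using TensorProduct.induction_on with
    | zero => simp
    | tmul a b => simp [smul_smul, mul_comm]
    | add u v hu hv => simp only [map_add, smul_add, TensorProduct.add_tmul, hu, hv]
  have key₃ : ∀ t : A ⊗[ℂ] A, lapp f (W.Δ (rapp k t)) = TensorProduct.lid ℂ A
      (TensorProduct.map f (rapp k) (TensorProduct.assoc ℂ A A A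
        (TensorProduct.map W.Δ LinearMap.id t))) := by
    intro t
    induction t using TensorProduct.induction_on with
    | zero => simp
    | tmul a b => rw [rapp_tmul, map_smul, map_smul, key₂]; rfl
    | add u v hu hv => simp only [map_add, hu, hv]
  rw [key₁, key₃, coassoc_apply]

theorem sweedlerEval_mul_left {l : A} (hl : l ∈ W.subL) (n : ℕ) (ψ : Fin (n + 1) → (A →ₗ[ℂ] ℂ))
    (x : A) : W.sweedlerEval n ψ (l * x) = W.sweedlerEval n
      (fun k => if k = 0 then ψ k ∘ₗ LinearMap.mulLeft ℂ l else ψ k) x := by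
  induction n generalizing x with
  | zero => simp [sweedlerEval]
  | succ n ih =>
    have key : ∀ t : A ⊗[ℂ] A, papp (W.sweedlerEval n (Fin.init ψ)) (ψ (Fin.last (n + 1)))
        ((l ⊗ₜ[ℂ] 1) * t) = papp (W.sweedlerEval n (fun k => if k = 0 then
          Fin.init ψ k ∘ₗ LinearMap.mulLeft ℂ l else Fin.init ψ k)) (ψ (Fin.last (n + 1))) t := by
      intro t
      induction t using TensorProduct.induction_on with
      | zero => simp
      | tmul a b => simp [ih]
      | add u v hu hv => simp only [map_add, mul_add, hu, hv]
    have hinit : Fin.init (fun k => if k = 0 then ψ k ∘ₗ LinearMap.mulLeft ℂ l else ψ k)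
        = fun k => if k = 0 then Fin.init ψ k ∘ₗ LinearMap.mulLeft ℂ l else Fin.init ψ k := by
      ext k : 1
      simp [Fin.init]
    simp only [sweedlerEval, LinearMap.comp_apply]
    rw [Δ_mul_left_of_mem_subL hl, key, hinit, if_neg (Fin.last_pos).ne']

theorem sweedlerEval_mul_right {r : A} (hr : r ∈ W.subR) (n : ℕ) (ψ : Fin (n + 1) → (A →ₗ[ℂ] ℂ))
    (x : A) : W.sweedlerEval n ψ (r * x) = W.sweedlerEval n
      (fun k => if k = Fin.last n then ψ k ∘ₗ LinearMap.mulLeft ℂ r else ψ k) x := by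
  cases n with
  | zero => simp [sweedlerEval]
  | succ n =>
    have key : ∀ (t : A ⊗[ℂ] A) (f k : A →ₗ[ℂ] ℂ), papp f k ((1 ⊗ₜ[ℂ] r) * t)
        = papp f (k ∘ₗ LinearMap.mulLeft ℂ r) t := by
      intro t f k
      induction t using TensorProduct.induction_on with
      | zero => simp
      | tmul a b => simp
      | add u v hu hv => simp only [map_add, mul_add, hu, hv]
    have hinit : Fin.init (fun k => if k = Fin.last (n + 1) then
        ψ k ∘ₗ LinearMap.mulLeft ℂ r else ψ k) = Fin.init ψ := by
      ext k : 1
      simp [Fin.init, (Fin.castSucc_lt_last k).ne]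
    simp only [sweedlerEval, LinearMap.comp_apply]
    rw [Δ_mul_left_of_mem_subR hr, key, hinit]
    simp

end WeakHopfData

theorem Ring.inverse_eq_of_mul_eq_one {R : Type*} [MonoidWithZero R] {x y : R} (h : x * y = 1)
    (h' : y * x = 1) : Ring.inverse x = y :=
  Ring.inverse_unit ⟨x, y, h, h'⟩

theorem isUnit_of_mul_eq_zero {A : Type*} [Ring A] [Algebra ℂ A] [FiniteDimensional ℂ A] {x : A}
    (hx : ∀ y, x * y = 0 → y = 0) : IsUnit x := by
  have hinj : Function.Injective (LinearMap.mulLeft ℂ x) :=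
    (injective_iff_map_eq_zero _).2 fun y hy => hx y hy
  obtain ⟨y, hy⟩ := LinearMap.surjective_of_injective hinj 1
  have hy : x * y = 1 := hy
  refine ⟨⟨x, y, hy, sub_eq_zero.1 (hx _ ?_)⟩, rfl⟩
  rw [mul_sub, ← mul_assoc, hy, one_mul, mul_one, sub_self]

theorem WeakHopfData.S_inverse {A : Type*} [NormedRing A] [StarRing A] [CStarRing A]
    [NormedAlgebra ℂ A] [StarModule ℂ A] [FiniteDimensional ℂ A] (W : WeakHopfData A) {x : A}
    (hx : IsUnit x) : W.S (Ring.inverse x) = Ring.inverse (W.S x) := by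
  refine (Ring.inverse_eq_of_mul_eq_one ?_ ?_).symm
  · rw [← W.S_antimul, Ring.inverse_mul_cancel _ hx, W.S_one]
  · rw [← W.S_antimul, Ring.mul_inverse_cancel _ hx, W.S_one]

theorem IsPosElem.star_eq {A : Type*} [Semigroup A] [StarMul A] {x : A} (hx : IsPosElem x) :
    star x = x := by
  obtain ⟨y, rfl⟩ := hx
  simp

namespace HaarPkg

open WeakHopfData

variable {A : Type*} [NormedRing A] [StarRing A] [CStarRing A]
  [NormedAlgebra ℂ A] [StarModule ℂ A] [FiniteDimensional ℂ A] (P : HaarPkg A)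

/-- The inverse of `gL`. -/
def gLInv : A := Ring.inverse P.gL

/-- The inverse of `gR`. -/
def gRInv : A := Ring.inverse P.gR

theorem gL_mem_subL : P.gL ∈ P.W.subL := mem_subL_iff_range.2 P.gL_mem

theorem gR_mem_subR : P.gR ∈ P.W.subR := mem_subR_iff_range.2 P.gR_mem

theorem gLInv_mem_subL : P.gLInv ∈ P.W.subL := inverse_mem_subL P.gL_mem_subL P.gL_unit

theorem S_gL : P.W.S P.gL = P.gR := P.gR_S.symm

theorem S_gLInv : P.W.S P.gLInv = P.gRInv := by
  rw [gLInv, P.W.S_inverse P.gL_unit, S_gL, gRInv]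

theorem gRInv_mem_subR : P.gRInv ∈ P.W.subR := by
  rw [← S_gLInv]
  exact S_mem_subR P.gLInv_mem_subL

@[simp]
theorem gL_mul_gLInv : P.gL * P.gLInv = 1 := Ring.mul_inverse_cancel _ P.gL_unit

@[simp]
theorem gLInv_mul_gL : P.gLInv * P.gL = 1 := Ring.inverse_mul_cancel _ P.gL_unit

@[simp]
theorem gR_mul_gRInv : P.gR * P.gRInv = 1 := Ring.mul_inverse_cancel _ P.gR_unit

@[simp]
theorem gRInv_mul_gR : P.gRInv * P.gR = 1 := Ring.inverse_mul_cancel _ P.gR_unit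

@[simp]
theorem gL_mul_gLInv_mul (x : A) : P.gL * (P.gLInv * x) = x := by simp [← mul_assoc]

@[simp]
theorem gLInv_mul_gL_mul (x : A) : P.gLInv * (P.gL * x) = x := by simp [← mul_assoc]

@[simp]
theorem gR_mul_gRInv_mul (x : A) : P.gR * (P.gRInv * x) = x := by simp [← mul_assoc]

@[simp]
theorem gRInv_mul_gR_mul (x : A) : P.gRInv * (P.gR * x) = x := by simp [← mul_assoc]

theorem gR_mul_gL : P.gR * P.gL = P.gL * P.gR := P.gLR_comm.symm

theorem gRInv_mul_gL : P.gRInv * P.gL = P.gL * P.gRInv :=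
  (commute_of_mem P.gL_mem_subL P.gRInv_mem_subR).symm

theorem gRInv_mul_gLInv : P.gRInv * P.gLInv = P.gLInv * P.gRInv :=
  (commute_of_mem P.gLInv_mem_subL P.gRInv_mem_subR).symm

theorem gR_mul_gL_mul (x : A) : P.gR * (P.gL * x) = P.gL * (P.gR * x) := by
  rw [← mul_assoc, gR_mul_gL, mul_assoc]

theorem gRInv_mul_gL_mul (x : A) : P.gRInv * (P.gL * x) = P.gL * (P.gRInv * x) := by
  rw [← mul_assoc, gRInv_mul_gL, mul_assoc]

theorem gRInv_mul_gLInv_mul (x : A) : P.gRInv * (P.gLInv * x) = P.gLInv * (P.gRInv * x) := by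
  rw [← mul_assoc, gRInv_mul_gLInv, mul_assoc]

theorem g_eq : P.g = P.gL * P.gRInv := rfl

theorem inverse_g : Ring.inverse P.g = P.gLInv * P.gR := by
  refine Ring.inverse_eq_of_mul_eq_one ?_ ?_
  · simp [g_eq, mul_assoc, gRInv_mul_gLInv_mul]
  · simp [g_eq, mul_assoc, gR_mul_gL_mul]

theorem S_S (x : A) : P.W.S (P.W.S x) = P.gL * (P.gRInv * (x * (P.gLInv * P.gR))) := by
  have h := P.S_sq x
  rw [← g, inverse_g, g_eq] at h
  simpa only [mul_assoc] using h

theorem S_gR : P.W.S P.gR = P.gL := by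
  rw [← S_gL, S_S]
  simp

theorem S_gRInv : P.W.S P.gRInv = P.gLInv := by
  rw [gRInv, P.W.S_inverse P.gR_unit, S_gR, gLInv]

theorem comm_Δ_h : TensorProduct.comm ℂ A A (P.W.Δ P.h)
    = (1 ⊗ₜ[ℂ] P.g) * P.W.Δ P.h * (1 ⊗ₜ[ℂ] P.g) := by
  rw [← P.haar_flip, ← g]
  induction P.W.Δ P.h using TensorProduct.induction_on with
  | zero => simp
  | tmul a b => simp [mul_assoc]
  | add u v hu hv => simp only [map_add, mul_add, add_mul, hu, hv]

/-- The quasi-basis `h₍₁₎ gL⁻² ⊗ h₍₂₎`, up to applying the antipode to the first leg. -/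
def quasi : A ⊗[ℂ] A := P.W.Δ (P.h * (P.gLInv * P.gLInv))

theorem quasi_eq : P.quasi = P.W.Δ P.h * ((P.gLInv * P.gLInv) ⊗ₜ[ℂ] 1) :=
  Δ_mul_right_of_mem_subL (mul_mem P.gLInv_mem_subL P.gLInv_mem_subL) _

theorem one_tmul_mul_quasi (x : A) :
    (1 ⊗ₜ[ℂ] x) * P.quasi = (P.W.S x ⊗ₜ[ℂ] 1) * P.quasi := by
  refine P.W.one_tmul_mul_Δ_of_integral (fun x => ?_) x
  rw [← mul_assoc, P.haar_left, mul_assoc]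

theorem rapp_hHat_quasi : rapp P.hHat P.quasi = 1 := P.hHat_dual₃

theorem iotaEl_eq : P.iotaEl = P.W.mulS P.quasi := rfl

theorem iotaEl_mem_subL : P.iotaEl ∈ P.W.subL := mem_subL_iff_range.2 ⟨_, rfl⟩

theorem iotaEl_comm (x : A) : Commute P.iotaEl x := by
  obtain ⟨y, rfl⟩ := P.W.S.surjective x
  have h := congrArg P.W.mulS (P.one_tmul_mul_quasi y)
  rwa [mulS_one_tmul_mul, mulS_tmul_one_mul, ← iotaEl_eq] at h

theorem S_iotaEl : P.W.S P.iotaEl = P.iotaEl := by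
  have key₁ : ∀ t : A ⊗[ℂ] A, P.W.S (P.W.mulS (t * ((P.gLInv * P.gLInv) ⊗ₜ[ℂ] 1)))
      = P.g * P.W.mulS (TensorProduct.comm ℂ A A t *
        ((P.gLInv * P.gRInv) ⊗ₜ[ℂ] 1)) := by
    intro t
    induction t using TensorProduct.induction_on with
    | zero => simp
    | tmul a b =>
      simp [S_antimul, S_S, S_gLInv, g_eq, mul_assoc]
    | add u v hu hv => simp only [map_add, mul_add, add_mul, hu, hv]
  have key₂ : ∀ t : A ⊗[ℂ] A, P.W.mulS ((1 ⊗ₜ[ℂ] P.g) * t * (1 ⊗ₜ[ℂ] P.g) *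
      ((P.gLInv * P.gRInv) ⊗ₜ[ℂ] 1)) =
      P.W.mulS (t * ((P.gLInv * P.gLInv) ⊗ₜ[ℂ] 1)) * Ring.inverse P.g := by
    intro t
    induction t using TensorProduct.induction_on with
    | zero => simp
    | tmul a b =>
      rw [inverse_g]
      simp [S_antimul, S_gL, S_gRInv, g_eq, mul_assoc, gRInv_mul_gLInv_mul]
    | add u v hu hv => simp only [map_add, mul_add, add_mul, hu, hv]
  rw [iotaEl_eq, quasi_eq, key₁, comm_Δ_h, key₂, ← quasi_eq, ← iotaEl_eq, ← mul_assoc,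
    ← (P.iotaEl_comm P.g).eq, Ring.mul_inverse_cancel_right P.g _ P.g_unit]

theorem iotaEl_mem_subR : P.iotaEl ∈ P.W.subR := by
  rw [← S_iotaEl]
  exact S_mem_subR P.iotaEl_mem_subL

theorem rapp_mulLeft_quasi (x : A) :
    rapp (P.hHat ∘ₗ LinearMap.mulLeft ℂ x) P.quasi = P.W.S x := by
  rw [← rapp_one_tmul_mul, one_tmul_mul_quasi, rapp_tmul_one_mul, rapp_hHat_quasi, mul_one]

theorem lapp_hHat_mul_tmul_one (x : A) :
    lapp P.hHat (P.W.Δ P.h * (x ⊗ₜ[ℂ] 1)) = P.gR * P.gR * P.W.S x := by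
  rw [P.W.Δ_mul_tmul_one_of_integral P.haar_left P.haar_S, lapp_mul_one_tmul, P.gR_sq]

theorem rapp_mulRight_quasi (x : A) :
    rapp (P.hHat ∘ₗ LinearMap.mulRight ℂ x) P.quasi
      = P.gL * P.gR * P.W.S x * (P.gLInv * P.gRInv) := by
  have h : P.W.Δ P.h * ((P.gLInv * P.gLInv) ⊗ₜ[ℂ] 1) * (1 ⊗ₜ[ℂ] x)
      = P.W.Δ P.h * (1 ⊗ₜ[ℂ] x) * ((P.gLInv * P.gLInv) ⊗ₜ[ℂ] 1) := by
    simp [mul_assoc]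
  have hx : TensorProduct.comm ℂ A A ((1 : A) ⊗ₜ[ℂ] x) = x ⊗ₜ[ℂ] 1 := rfl
  have hx' : ((1 : A) ⊗ₜ[ℂ] P.g) * (x ⊗ₜ[ℂ] (1 : A)) = (x ⊗ₜ[ℂ] 1) * (1 ⊗ₜ[ℂ] P.g) := by simp
  rw [← rapp_mul_one_tmul, quasi_eq, h, rapp_mul_tmul_one, ← lapp_comm, comm_mul, hx, comm_Δ_h,
    mul_assoc, hx', mul_assoc, lapp_one_tmul_mul, ← mul_assoc (P.W.Δ P.h), lapp_mul_one_tmul,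
    lapp_hHat_mul_tmul_one]
  simp [g_eq, mul_assoc, gRInv_mul_gLInv, gRInv_mul_gLInv_mul]

theorem eq_of_rapp_quasi {f k : A →ₗ[ℂ] ℂ} (hfk : rapp f P.quasi = rapp k P.quasi) : f = k := by
  ext y
  obtain ⟨ψ, -, hψ, -⟩ := P.haar_nondeg y
  have h : lapp (ψ ∘ₗ LinearMap.mulRight ℂ (P.gL * P.gL)) P.quasi = y := by
    rw [quasi_eq, lapp_mul_right, ← hψ]
    congr 1
    ext z
    simp [mul_assoc]
  rw [← h, apply_lapp_eq_apply_rapp, apply_lapp_eq_apply_rapp, hfk]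

theorem hHat_mul_comm (z x : A) :
    P.hHat (z * x) = P.hHat (P.gLInv * P.gRInv * x * (P.gL * P.gR) * z) := by
  refine LinearMap.congr_fun (P.eq_of_rapp_quasi (f := P.hHat ∘ₗ LinearMap.mulRight ℂ x)
    (k := P.hHat ∘ₗ LinearMap.mulLeft ℂ (P.gLInv * P.gRInv * x * (P.gL * P.gR))) ?_) z
  rw [rapp_mulRight_quasi, rapp_mulLeft_quasi]
  simp [S_antimul, S_gL, S_gR, S_gLInv, S_gRInv, mul_assoc]

theorem eq_zero_of_hHat_mul_left {x : A} (hx : ∀ z, P.hHat (z * x) = 0) : x = 0 := by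
  have h := P.rapp_mulRight_quasi x
  have h0 : P.hHat ∘ₗ LinearMap.mulRight ℂ x = 0 := LinearMap.ext hx
  have h1 : rapp (0 : A →ₗ[ℂ] ℂ) P.quasi = 0 := by simp [rapp]
  rw [h0, h1] at h
  have h2 : P.gLInv * P.gRInv * (P.gL * P.gR * P.W.S x * (P.gLInv * P.gRInv)) * (P.gL * P.gR)
      = P.W.S x := by
    simp [mul_assoc, gRInv_mul_gL_mul]
  rw [← h, mul_zero, zero_mul] at h2
  exact P.W.S.map_eq_zero_iff.1 h2.symm

end HaarPkg

theorem map_star_of_nonneg {A : Type*} [Ring A] [StarRing A] [Algebra ℂ A] [StarModule ℂ A]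
    (f : A →ₗ[ℂ] ℂ) (hf : ∀ x, ∃ r : ℝ, 0 ≤ r ∧ f (star x * x) = (r : ℂ)) (x : A) :
    f (star x) = star (f x) := by
  have him : ∀ y, (f (star y * y)).im = 0 := fun y => by
    obtain ⟨r, -, hr⟩ := hf y
    simp [hr]
  have h₁ := him 1
  have hx := him x
  have h₂ := him (1 + x)
  have h₃ := him (1 + Complex.I • x)
  simp only [star_one, one_mul] at h₁
  simp only [star_add, star_one, star_smul, add_mul, mul_add, one_mul, mul_one, map_add,
    smul_mul_assoc, mul_smul_comm, map_smul, smul_eq_mul, Complex.add_im, Complex.mul_im,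
    Complex.mul_re, Complex.I_re, Complex.I_im, Complex.star_def, Complex.conj_I,
    Complex.neg_re, Complex.neg_im,
    h₁, hx] at h₂ h₃
  apply Complex.ext <;> simp only [Complex.star_def, Complex.conj_re, Complex.conj_im] <;>
    linarith

namespace HaarPkg

open WeakHopfData

variable {A : Type*} [NormedRing A] [StarRing A] [CStarRing A]
  [NormedAlgebra ℂ A] [StarModule ℂ A] [FiniteDimensional ℂ A] (P : HaarPkg A)

theorem hHat_star (x : A) : P.hHat (star x) = star (P.hHat x) :=
  map_star_of_nonneg _ P.hHat_pos x

/-- The positive semidefinite form `⟨ĥ, x* y⟩`. -/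
@[reducible]
def preCore : PreInnerProductSpace.Core ℂ A where
  inner x y := P.hHat (star x * y)
  conj_inner_symm x y := by
    rw [← Complex.star_def, ← hHat_star, star_mul, star_star]
  re_inner_nonneg x := by
    obtain ⟨r, hr, h⟩ := P.hHat_pos x
    simpa [h] using hr
  add_left x y z := by simp [add_mul]
  smul_left x y r := by simp

theorem eq_zero_of_hHat_star_mul_self {x : A} (hx : P.hHat (star x * x) = 0) : x = 0 := by
  refine P.eq_zero_of_hHat_mul_left fun z => ?_
  let c := P.preCore
  have h := InnerProductSpace.Core.inner_mul_inner_self_le (𝕜 := ℂ) (star z) x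
  change ‖P.hHat (star (star z) * x)‖ * ‖P.hHat (star x * star z)‖ ≤
    RCLike.re (P.hHat (star (star z) * star z)) * RCLike.re (P.hHat (star x * x)) at h
  rw [hx, ← star_mul, hHat_star, star_star, map_zero, mul_zero, norm_star] at h
  have := mul_self_eq_zero.1 (le_antisymm h (mul_self_nonneg _))
  exact norm_eq_zero.1 this

/-- The inner product `⟨ĥ, x* y⟩`. -/
@[reducible]
def core : InnerProductSpace.Core ℂ A where
  __ := P.preCore
  definite _ h := P.eq_zero_of_hHat_star_mul_self h

theorem exists_orthonormal_basis : ∃ b : Module.Basis (Fin (Module.finrank ℂ A)) ℂ A,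
    (∀ i j, P.hHat (star (b i) * b j) = if i = j then 1 else 0) ∧
    ∀ i, b.coord i = P.hHat ∘ₗ LinearMap.mulLeft ℂ (star (b i)) := by
  obtain ⟨b, hb⟩ := exists_basis_of_inner_core P.core
  have hb : ∀ i j, P.hHat (star (b i) * b j) = if i = j then 1 else 0 := hb
  refine ⟨b, hb, fun i => b.ext fun j => ?_⟩
  simp [hb, Finsupp.single_apply, eq_comm]

theorem iotaEl_eq_sum {ι : Type*} [Fintype ι] (b : Module.Basis ι ℂ A)
    (hb : ∀ i, b.coord i = P.hHat ∘ₗ LinearMap.mulLeft ℂ (star (b i))) :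
    P.iotaEl = ∑ i, star (star (b i)) * star (b i) := by
  apply P.W.S.injective
  rw [S_iotaEl, iotaEl_eq, eq_sum_rapp_tmul b P.quasi]
  simp [hb, rapp_mulLeft_quasi, S_antimul]

theorem star_gLInv : star P.gLInv = P.gLInv := by
  rw [gLInv, ← Ring.inverse_star, P.gL_pos.star_eq]

theorem starT_sum {ι : Type*} (s : Finset ι) (f : ι → A ⊗[ℂ] A) :
    P.W.starT (∑ i ∈ s, f i) = ∑ i ∈ s, P.W.starT (f i) :=
  map_sum (AddMonoidHom.mk' P.W.starT P.W.starT_add) f s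

theorem jayEl_eq_sum {ι : Type*} [Fintype ι] [DecidableEq ι] (b : Module.Basis ι ℂ A)
    (hb : ∀ i j, P.hHat (star (b i) * b j) = if i = j then 1 else 0) :
    P.jayEl = ∑ i, star (lapp (b.coord i) (P.W.Δ P.gLInv)) *
      lapp (b.coord i) (P.W.Δ P.gLInv) := by
  have h : P.jayEl = lapp P.hHat (P.W.starT (P.W.Δ P.gLInv) * P.W.Δ P.gLInv) := by
    rw [← P.W.Δ_star, star_gLInv, ← P.W.Δ_mul]
    rfl
  rw [h]
  conv_lhs => rw [eq_sum_tmul_lapp b (P.W.Δ P.gLInv)]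
  simp [starT_sum, P.W.starT_tmul, Finset.sum_mul, Finset.mul_sum, hb]

theorem isPosElem_iotaEl : IsPosElem P.iotaEl := by
  let : CStarAlgebra A := { complete := (FiniteDimensional.complete ℂ A).complete }
  obtain ⟨b, -, hb⟩ := P.exists_orthonormal_basis
  rw [P.iotaEl_eq_sum b hb]
  exact CStarAlgebra.isPosElem_sum _ _ fun i _ => ⟨_, rfl⟩

theorem isUnit_iotaEl : IsUnit P.iotaEl := by
  let : CStarAlgebra A := { complete := (FiniteDimensional.complete ℂ A).complete }
  obtain ⟨b, -, hb⟩ := P.exists_orthonormal_basis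
  refine isUnit_of_mul_eq_zero fun x hx => ?_
  rw [P.iotaEl_eq_sum b hb] at hx
  have h := CStarAlgebra.mul_eq_zero_of_sum_star_mul_self _ hx
  have h0 : LinearMap.mulLeft ℂ (star x) = 0 := b.ext fun i => by
    simpa using congrArg star (h i)
  simpa using LinearMap.congr_fun h0 1

theorem isPosElem_jayEl : IsPosElem P.jayEl := by
  let : CStarAlgebra A := { complete := (FiniteDimensional.complete ℂ A).complete }
  obtain ⟨b, hb, -⟩ := P.exists_orthonormal_basis
  rw [P.jayEl_eq_sum b hb]
  exact CStarAlgebra.isPosElem_sum _ _ fun i _ => ⟨_, rfl⟩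

theorem isUnit_jayEl : IsUnit P.jayEl := by
  let : CStarAlgebra A := { complete := (FiniteDimensional.complete ℂ A).complete }
  obtain ⟨b, hb, -⟩ := P.exists_orthonormal_basis
  refine isUnit_of_mul_eq_zero fun x hx => ?_
  rw [P.jayEl_eq_sum b hb] at hx
  have h := CStarAlgebra.mul_eq_zero_of_sum_star_mul_self _ hx
  have h0 : P.W.Δ P.gLInv * (1 ⊗ₜ[ℂ] x) = 0 := by
    rw [eq_sum_tmul_lapp b (P.W.Δ P.gLInv * (1 ⊗ₜ[ℂ] x))]
    simp [lapp_mul_one_tmul, h]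
  have h1 := congrArg (lapp P.W.ε) h0
  rw [lapp_mul_one_tmul, lapp_ε, map_zero] at h1
  rw [← P.gL_mul_gLInv_mul x, h1, mul_zero]

theorem jayEl_eq : P.jayEl = lapp P.hHat (P.W.Δ (P.gLInv * P.gLInv)) := rfl

theorem jayEl_mem_subL : P.jayEl ∈ P.W.subL := by
  rw [jayEl_eq, mem_subL.1 (mul_mem P.gLInv_mem_subL P.gLInv_mem_subL), lapp_mul_left]
  exact lapp_Δ_one_mem_subL _

theorem lapp_hHat_Δ_mem_subR (z : A) : lapp P.hHat (P.W.Δ z) ∈ P.W.subR := by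
  obtain ⟨-, ψ, -, hψ⟩ := P.haar_nondeg z
  have h : rapp (ψ ∘ₗ LinearMap.mulLeft ℂ (P.gR * P.gR))
      (P.W.Δ (P.gRInv * P.gRInv * P.h)) = z := by
    rw [Δ_mul_left_of_mem_subR (mul_mem P.gRInv_mem_subR P.gRInv_mem_subR), rapp_one_tmul_mul,
      ← hψ]
    congr 1
    ext z
    simp
  rw [← h, ← rapp_Δ_lapp_Δ, gRInv, P.hHat_dual₄]
  exact rapp_Δ_one_mem_subR _

theorem jayEl_mem_subR : P.jayEl ∈ P.W.subR := P.lapp_hHat_Δ_mem_subR _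

theorem S_jayEl : P.W.S P.jayEl = P.jayEl := S_eq_self P.jayEl_mem_subL P.jayEl_mem_subR

theorem ε_mul_jayEl (x : A) :
    P.W.ε (x * P.jayEl) = P.hHat (P.W.εR x * (P.gLInv * P.gLInv)) := by
  have h : P.jayEl = lapp P.hHat (P.W.Δ 1 * ((P.gLInv * P.gLInv) ⊗ₜ[ℂ] 1)) := by
    rw [← Δ_of_mem_subL (mul_mem P.gLInv_mem_subL P.gLInv_mem_subL)]
    rfl
  have h' := apply_lapp_eq_apply_rapp P.hHat (P.W.ε ∘ₗ LinearMap.mulLeft ℂ x)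
    (P.W.Δ 1 * ((P.gLInv * P.gLInv) ⊗ₜ[ℂ] 1))
  rwa [← h, rapp_mul_tmul_one, ← εR_eq] at h'

theorem ε_S_mul_jayEl (x : A) :
    P.W.ε (P.W.S x * P.jayEl) = P.hHat (P.W.εL x * (P.gRInv * P.gRInv)) := by
  have hl := mul_mem P.gLInv_mem_subL P.gLInv_mem_subL
  have hr : P.W.εR (P.W.S x) ∈ P.W.subR := mem_subR_iff_range.2 ⟨_, rfl⟩
  rw [ε_mul_jayEl, ← (commute_of_mem hl hr).eq, εR_S, ← P.hHat_S (P.W.εL x * _), S_antimul,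
    S_antimul, S_gRInv]

theorem hHat_εL_S_mul (x : A) : P.hHat (P.W.εL (P.W.S x) * (P.gRInv * P.gRInv))
    = P.hHat (P.W.εL x * (P.gRInv * P.gRInv)) := by
  rw [← mulS_Δ, ← mulS_Δ, S_anticomul]
  induction P.W.Δ x using TensorProduct.induction_on with
  | zero => simp
  | add u v hu hv => simp only [map_add, add_mul, hu, hv]
  | tmul a b =>
    have h₁ := P.hHat_mul_comm a (P.W.S b * (P.gRInv * P.gRInv))
    have h₂ := P.hHat_mul_comm (P.W.S b * (P.gL * (P.gRInv * a))) (P.gLInv * P.gRInv)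
    simp only [mul_assoc, gRInv_mul_gL_mul, gRInv_mul_gR_mul, gLInv_mul_gL_mul,
      gRInv_mul_gLInv_mul] at h₁ h₂
    simp only [TensorProduct.map_tmul, TensorProduct.comm_tmul, LinearEquiv.coe_coe, mulS_tmul,
      S_S, mul_assoc, gR_mul_gRInv_mul]
    rw [h₁, h₂]

theorem jayEl_comm (x : A) : Commute P.jayEl x := by
  refine mul_comm_of_ε P.jayEl_mem_subL (fun y => ?_) x
  have h : P.W.ε (P.W.S y * P.jayEl) = P.W.ε (y * P.jayEl) := by
    obtain ⟨x, rfl⟩ := P.W.S.surjective y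
    rw [ε_S_mul_jayEl, ε_S_mul_jayEl, hHat_εL_S_mul]
  rw [← h, ← P.W.ε_S, S_antimul, S_jayEl]

theorem sqrt_mem {x : A} (hx : IsPosElem x) (B : Subalgebra ℂ A) (hB : x ∈ B) : P.sqrt x ∈ B := by
  let : CStarAlgebra A := { complete := (FiniteDimensional.complete ℂ A).complete }
  obtain ⟨p, hp⟩ := CStarAlgebra.exists_aeval_eq_of_mul_self hx (P.sqrt_pos x hx)
    (P.sqrt_mul_self x hx)
  rw [← hp]
  exact Algebra.adjoin_le (S := B.restrictScalars ℝ) (Set.singleton_subset_iff.2 hB)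
    (Polynomial.aeval_mem_adjoin_singleton ℝ x)

theorem commute_sqrt {x y : A} (hx : IsPosElem x) (h : Commute x y) : Commute (P.sqrt x) y := by
  have := P.sqrt_mem hx (Subalgebra.centralizer ℂ {y})
    (Subalgebra.mem_centralizer_iff ℂ |>.2 (by rintro _ rfl; exact h.eq.symm))
  exact ((Subalgebra.mem_centralizer_iff ℂ).1 this y rfl).symm

theorem isUnit_sqrt {x : A} (hx : IsPosElem x) (h : IsUnit x) : IsUnit (P.sqrt x) := by
  rw [← P.sqrt_mul_self x hx] at h
  exact ((Commute.refl _).isUnit_mul_iff.1 h).1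

/-- The central factor `ı^{1/2} ȷ^{1/2}` of `ξ_L` and `ξ_R`. -/
def sqrtIndex : A := P.sqrt P.iotaEl * P.sqrt P.jayEl

theorem sqrtIndex_comm (x : A) : Commute P.sqrtIndex x :=
  (P.commute_sqrt P.isPosElem_iotaEl (P.iotaEl_comm x)).mul_left
    (P.commute_sqrt P.isPosElem_jayEl (P.jayEl_comm x))

theorem sqrtIndex_mem_subL : P.sqrtIndex ∈ P.W.subL :=
  mul_mem (P.sqrt_mem P.isPosElem_iotaEl _ P.iotaEl_mem_subL)
    (P.sqrt_mem P.isPosElem_jayEl _ P.jayEl_mem_subL)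

theorem sqrtIndex_mem_subR : P.sqrtIndex ∈ P.W.subR :=
  mul_mem (P.sqrt_mem P.isPosElem_iotaEl _ P.iotaEl_mem_subR)
    (P.sqrt_mem P.isPosElem_jayEl _ P.jayEl_mem_subR)

theorem S_sqrtIndex : P.W.S P.sqrtIndex = P.sqrtIndex :=
  S_eq_self P.sqrtIndex_mem_subL P.sqrtIndex_mem_subR

theorem isPosElem_sqrtIndex : IsPosElem P.sqrtIndex := by
  let : CStarAlgebra A := { complete := (FiniteDimensional.complete ℂ A).complete }
  exact CStarAlgebra.isPosElem_mul (P.sqrt_pos _ P.isPosElem_iotaEl)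
    (P.sqrt_pos _ P.isPosElem_jayEl) (P.commute_sqrt P.isPosElem_iotaEl (P.iotaEl_comm _))

theorem isUnit_sqrtIndex : IsUnit P.sqrtIndex :=
  (P.isUnit_sqrt P.isPosElem_iotaEl P.isUnit_iotaEl).mul
    (P.isUnit_sqrt P.isPosElem_jayEl P.isUnit_jayEl)

theorem ξL_eq : P.ξL = P.sqrtIndex * P.gL := rfl

theorem ξR_eq : P.ξR = P.sqrtIndex * P.gR := rfl

theorem ξL_mem_subL : P.ξL ∈ P.W.subL := mul_mem P.sqrtIndex_mem_subL P.gL_mem_subL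

theorem ξR_mem_subR : P.ξR ∈ P.W.subR := mul_mem P.sqrtIndex_mem_subR P.gR_mem_subR

theorem isPosElem_ξL : IsPosElem P.ξL := by
  let : CStarAlgebra A := { complete := (FiniteDimensional.complete ℂ A).complete }
  exact CStarAlgebra.isPosElem_mul P.isPosElem_sqrtIndex P.gL_pos (P.sqrtIndex_comm _)

theorem isPosElem_ξR : IsPosElem P.ξR := by
  let : CStarAlgebra A := { complete := (FiniteDimensional.complete ℂ A).complete }
  exact CStarAlgebra.isPosElem_mul P.isPosElem_sqrtIndex P.gR_pos (P.sqrtIndex_comm _)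

theorem isUnit_ξL : IsUnit P.ξL := P.isUnit_sqrtIndex.mul P.gL_unit

theorem isUnit_ξR : IsUnit P.ξR := P.isUnit_sqrtIndex.mul P.gR_unit

theorem isPosElem_ξ : IsPosElem P.ξ := by
  let : CStarAlgebra A := { complete := (FiniteDimensional.complete ℂ A).complete }
  exact CStarAlgebra.isPosElem_mul P.isPosElem_ξL P.isPosElem_ξR
    (commute_of_mem P.ξL_mem_subL P.ξR_mem_subR)

theorem isUnit_ξ : IsUnit P.ξ := P.isUnit_ξL.mul P.isUnit_ξR

theorem S_ξL : P.W.S P.ξL = P.ξR := by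
  rw [ξL_eq, S_antimul, S_sqrtIndex, S_gL, ← (P.sqrtIndex_comm _).eq, ξR_eq]

theorem S_ξR : P.W.S P.ξR = P.ξL := by
  rw [ξR_eq, S_antimul, S_sqrtIndex, S_gR, ← (P.sqrtIndex_comm _).eq, ξL_eq]

theorem S_ξ : P.W.S P.ξ = P.ξ := by
  rw [ξ, S_antimul, S_ξL, S_ξR]

theorem g_mul_ξR : P.g * P.ξR = P.ξL := by
  rw [ξR_eq, ξL_eq, ← mul_assoc, ← (P.sqrtIndex_comm _).eq, mul_assoc, g_eq]
  simp [mul_assoc]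

theorem isPosElem_g : IsPosElem P.g := P.g_pos

theorem isUnit_g : IsUnit P.g := P.g_unit

theorem commute_g_ξL : Commute P.g P.ξL :=
  (P.sqrtIndex_comm _).symm.mul_right <| (Commute.refl P.gL).mul_left
    (commute_of_mem P.gL_mem_subL P.gRInv_mem_subR).symm

theorem commute_g_ξR : Commute P.g P.ξR := by
  have : Commute P.g P.gR := (show Commute P.gL P.gR from P.gLR_comm).mul_left
    ((P.gRInv_mul_gR).trans (P.gR_mul_gRInv).symm)
  exact (P.sqrtIndex_comm _).symm.mul_right this

theorem commute_g_ξ : Commute P.g P.ξ := P.commute_g_ξL.mul_right P.commute_g_ξR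

theorem Jlin_apply (x : A) :
    P.Jlin x = Ring.inverse (P.sqrt P.g) * P.W.S x * P.sqrt P.g := rfl

theorem Jlin_eq_of_commute {x : A} (hx : Commute P.g (P.W.S x)) : P.Jlin x = P.W.S x := by
  rw [Jlin_apply, mul_assoc, ← (P.commute_sqrt P.isPosElem_g hx).eq,
    Ring.inverse_mul_cancel_left _ _ (P.isUnit_sqrt P.isPosElem_g P.isUnit_g)]

theorem commute_sqrt_g_sqrt_ξ : Commute (P.sqrt P.g) (P.sqrt P.ξ) :=
  (P.commute_sqrt P.isPosElem_ξ (P.commute_sqrt P.isPosElem_g P.commute_g_ξ).symm).symm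

theorem sqrt_g_mul_sqrt_ξ : P.sqrt P.g * P.sqrt P.ξ = P.ξL := by
  let : CStarAlgebra A := { complete := (FiniteDimensional.complete ℂ A).complete }
  refine CStarAlgebra.eq_of_mul_self_eq (CStarAlgebra.isPosElem_mul (P.sqrt_pos _ P.isPosElem_g)
    (P.sqrt_pos _ P.isPosElem_ξ) P.commute_sqrt_g_sqrt_ξ) P.isPosElem_ξL ?_
  rw [P.commute_sqrt_g_sqrt_ξ.symm.mul_mul_mul_comm, P.sqrt_mul_self _ P.isPosElem_g,
    P.sqrt_mul_self _ P.isPosElem_ξ, ξ,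
    ← mul_assoc, P.commute_g_ξL.eq, mul_assoc, g_mul_ξR]

theorem JL_eq (x : A) :
    P.JL x = Ring.inverse (P.sqrt P.ξ) * P.Jlin x * P.sqrt P.ξ := by
  have hx : P.W.S x * P.sqrt P.g * P.sqrt P.ξ = P.sqrt P.g * P.sqrt P.ξ * P.JL x := by
    rw [mul_assoc, sqrt_g_mul_sqrt_ξ, JL, ← gLInv, ξL_eq, ← mul_assoc,
      ← (P.sqrtIndex_comm _).eq]
    simp [mul_assoc]
  rw [Jlin_apply, mul_assoc, mul_assoc, mul_assoc, ← mul_assoc (P.W.S x), hx, mul_assoc,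
    Ring.inverse_mul_cancel_left _ _ (P.isUnit_sqrt P.isPosElem_g P.isUnit_g),
    Ring.inverse_mul_cancel_left _ _ (P.isUnit_sqrt P.isPosElem_ξ P.isUnit_ξ)]

theorem JR_eq (x : A) :
    P.JR x = P.sqrt P.ξ * P.Jlin x * Ring.inverse (P.sqrt P.ξ) := by
  have hs := P.isUnit_sqrt P.isPosElem_g P.isUnit_g
  have ht := P.isUnit_sqrt P.isPosElem_ξ P.isUnit_ξ
  have hx : P.W.S x * P.sqrt P.g * P.sqrt P.g
      = P.sqrt P.g * (P.sqrt P.g * P.W.S.symm x) := by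
    have h := P.S_sq (P.W.S.symm x)
    rw [P.W.S.apply_symm_apply, ← g] at h
    rw [mul_assoc, ← mul_assoc (P.sqrt P.g), P.sqrt_mul_self _ P.isPosElem_g, h,
      Ring.inverse_mul_cancel_right _ _ P.isUnit_g]
  rw [Ring.eq_mul_inverse_iff_mul_eq _ _ _ ht, ← hs.mul_left_inj, mul_assoc, Jlin_apply,
    ← P.commute_sqrt_g_sqrt_ξ.eq, sqrt_g_mul_sqrt_ξ, mul_assoc (P.sqrt P.ξ),
    mul_assoc (Ring.inverse _), mul_assoc (Ring.inverse _), hx,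
    Ring.inverse_mul_cancel_left _ _ hs, ← mul_assoc, ← P.commute_sqrt_g_sqrt_ξ.eq,
    sqrt_g_mul_sqrt_ξ, JR, ← gLInv, ξL_eq, (P.sqrtIndex_comm _).eq]
  simp [mul_assoc, (P.sqrtIndex_comm _).eq]

end HaarPkg

/-- **Properties of `ξ_L`, `ξ_R` and `ξ`.**
`ξ_L ∈ A^L`, `ξ_R ∈ A^R`, `ξ_R = J ξ_L`, `ξ = ξ_L ξ_R` is positive and invertible with
`J ξ = ξ`, `g = ξ_L ξ_R⁻¹`, `J^L = Ad(ξ^{-1/2}) ∘ J` and `J^R = Ad(ξ^{1/2}) ∘ J`; finally,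
for every `n ≥ 1`, `Δ⁽ⁿ⁾ ξ = ξ_L 1₍₁₎ ⊗ 1₍₂₎ ⊗ ⋯ ⊗ 1₍ₙ₎ ⊗ ξ_R 1₍ₙ₊₁₎` (expressed,
equivalently, through full contractions against arbitrary linear functionals, which
separate the points of tensor powers). -/
theorem HaarPkg.xi_properties {A : Type*} [NormedRing A] [StarRing A] [CStarRing A]
    [NormedAlgebra ℂ A] [StarModule ℂ A] [FiniteDimensional ℂ A]
    (P : HaarPkg A) :
    P.ξL ∈ Set.range (WeakHopfData.εL P.W) ∧
    P.ξR ∈ Set.range (WeakHopfData.εR P.W) ∧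
    P.ξR = P.Jlin P.ξL ∧
    IsPosElem P.ξ ∧ IsUnit P.ξ ∧ P.Jlin P.ξ = P.ξ ∧
    P.g = P.ξL * Ring.inverse P.ξR ∧
    (∀ x : A, P.JL x = Ring.inverse (P.sqrt P.ξ) * P.Jlin x * P.sqrt P.ξ) ∧
    (∀ x : A, P.JR x = P.sqrt P.ξ * P.Jlin x * Ring.inverse (P.sqrt P.ξ)) ∧
    (∀ n : ℕ, 1 ≤ n → ∀ ψ : Fin (n + 1) → (A →ₗ[ℂ] ℂ),
      WeakHopfData.sweedlerEval P.W n ψ P.ξ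
        = WeakHopfData.sweedlerEval P.W n
            (fun k => if k = 0 then ψ k ∘ₗ LinearMap.mulLeft ℂ P.ξL
              else if k = Fin.last n then ψ k ∘ₗ LinearMap.mulLeft ℂ P.ξR
              else ψ k) 1) := by
  refine ⟨WeakHopfData.mem_subL_iff_range.1 P.ξL_mem_subL,
    WeakHopfData.mem_subR_iff_range.1 P.ξR_mem_subR, ?_, P.isPosElem_ξ, P.isUnit_ξ, ?_, ?_,
    P.JL_eq, P.JR_eq, fun n hn ψ => ?_⟩
  · rw [P.Jlin_eq_of_commute (by rw [S_ξL]; exact P.commute_g_ξR), S_ξL]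
  · rw [P.Jlin_eq_of_commute (by rw [S_ξ]; exact P.commute_g_ξ), S_ξ]
  · rw [Ring.eq_mul_inverse_iff_mul_eq _ _ _ P.isUnit_ξR, g_mul_ξR]
  · obtain ⟨n, rfl⟩ := Nat.exists_eq_succ_of_ne_zero (Nat.one_le_iff_ne_zero.1 hn)
    rw [ξ, ← mul_one P.ξR, P.W.sweedlerEval_mul_left P.ξL_mem_subL,
      P.W.sweedlerEval_mul_right P.ξR_mem_subR]
    congr 2
    ext k : 1
    by_cases h0 : k = 0
    · subst h0
      simp
    · simp [h0]

end
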